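/- arXiv:2011.01692 — 2 statements merged into one kernel-verified Lean document; each statement's English description precedes it below -/
import Mathlib

section
/- Let k ∈ ℕ, and let A⁺, A⁻ ∈ S² with angle θ between them satisfying θ ∈ (0,π). Then there exists α_k ∈ (0,1) such that for every α ∈ [α_k, 1] there exist a strictly increasing sequence 0 < c₁ < c₂ < ⋯ < c_k and rotations R₁, …, R_k ∈ SO(3) such that, for each j, the function m_j(x,t) := R_j( m_{c_j,α}(x/√t) ) is a C^∞ solution of ∂ₜm = β m × ∂ₓₓm − α m × (m × ∂ₓₓm) on ℝ × (0,∞) satisfying lim_{t→0⁺} m_j(x,t) = A⁺ for every x > 0 and lim_{t→0⁺} m_j(x,t) = A⁻ for every x < 0; these k solutions are pairwise distinct since √t ‖∂ₓm_j(·,t)‖_{L^∞(ℝ)} = c_j for all t > 0. Moreover, if α = 1 and θ ∈ [0,π], then there is an infinite sequence of such pairwise distinct smooth self-similar solutions with the same initial condition A⁺χ_{(0,∞)} + A⁻χ_{(−∞,0)}. -/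
noncomputable section

open Real MeasureTheory Filter Topology

/-- `E3` is `ℝ³` with the Euclidean norm. -/
abbrev E3 : Type := EuclideanSpace ℝ (Fin 3)

def toE3 (v : Fin 3 → ℝ) : E3 := (WithLp.equiv 2 (Fin 3 → ℝ)).symm v

/-- The cross product in `ℝ³`. -/
def cross (a b : E3) : E3 :=
  toE3 ![a 1 * b 2 - a 2 * b 1, a 2 * b 0 - a 0 * b 2, a 0 * b 1 - a 1 * b 0]

def e1 : E3 := EuclideanSpace.single 0 1
def e2 : E3 := EuclideanSpace.single 1 1
def e3 : E3 := EuclideanSpace.single 2 1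

/-- `(m, n, b)` solves the Serret–Frenet system with curvature `k(x) = c e^{-αx²/4}`,
torsion `τ(x) = βx/2` and initial conditions `(e₁, e₂, e₃)`. -/
def IsSF (α β c : ℝ) (m n b : ℝ → E3) : Prop :=
  (∀ x : ℝ, HasDerivAt m ((c * Real.exp (-α * x ^ 2 / 4)) • n x) x) ∧
  (∀ x : ℝ, HasDerivAt n
    ((-(c * Real.exp (-α * x ^ 2 / 4))) • m x + (β * x / 2) • b x) x) ∧
  (∀ x : ℝ, HasDerivAt b ((-(β * x / 2)) • n x) x) ∧
  m 0 = e1 ∧ n 0 = e2 ∧ b 0 = e3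

/-- A rotation of `ℝ³` preserving orientation: a linear isometry with determinant `1`. -/
def IsRotation (R : E3 ≃ₗᵢ[ℝ] E3) : Prop :=
  LinearMap.det (R.toLinearEquiv : E3 →ₗ[ℝ] E3) = 1

/-- `R ∘ m_{c,α}(x/√t)` is a smooth self-similar solution of the LLG equation on `ℝ × (0,∞)`
with initial condition `A⁺ χ_{(0,∞)} + A⁻ χ_{(-∞,0)}` and `√t ‖∂ₓ·‖_{L^∞} = c`. -/
def IsSelfSimSolution (α β c : ℝ) (R : E3 ≃ₗᵢ[ℝ] E3) (Ap Am : E3) : Prop :=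
  ∀ m n b : ℝ → E3, IsSF α β c m n b →
    ContDiffOn ℝ (⊤ : ℕ∞)
      (fun p : ℝ × ℝ => R (m (p.1 / Real.sqrt p.2))) (Set.univ ×ˢ Set.Ioi 0) ∧
    (∀ x : ℝ, ∀ t : ℝ, 0 < t →
      deriv (fun s => R (m (x / Real.sqrt s))) t =
        β • cross (R (m (x / Real.sqrt t)))
            (deriv (deriv (fun y => R (m (y / Real.sqrt t)))) x)
          - α • cross (R (m (x / Real.sqrt t)))
              (cross (R (m (x / Real.sqrt t)))
                (deriv (deriv (fun y => R (m (y / Real.sqrt t)))) x))) ∧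
    (∀ x : ℝ, 0 < x →
      Tendsto (fun t => R (m (x / Real.sqrt t))) (nhdsWithin 0 (Set.Ioi 0)) (nhds Ap)) ∧
    (∀ x : ℝ, x < 0 →
      Tendsto (fun t => R (m (x / Real.sqrt t))) (nhdsWithin 0 (Set.Ioi 0)) (nhds Am)) ∧
    (∀ t : ℝ, 0 < t →
      Real.sqrt t * (⨆ x : ℝ, ‖deriv (fun y => R (m (y / Real.sqrt t))) x‖) = c)

open scoped RealInnerProductSpace NNReal

/-- A curve whose velocity is everywhere orthogonal to its position has constant norm. -/
theorem norm_eq_of_inner_deriv_eq_zero {E : Type*} [NormedAddCommGroup E] [InnerProductSpace ℝ E]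
    {f f' : ℝ → E} {s : Set ℝ} (hs : Convex ℝ s)
    (hf : ∀ t ∈ s, HasDerivWithinAt f (f' t) s t) (horth : ∀ t ∈ s, ⟪f t, f' t⟫ = 0)
    {a b : ℝ} (ha : a ∈ s) (hb : b ∈ s) : ‖f a‖ = ‖f b‖ := by
  have hd : ∀ t ∈ s, HasDerivWithinAt (fun t => ‖f t‖ ^ 2) 0 s t := fun t ht => by
    have h := (hf t ht).norm_sq
    rwa [horth t ht, mul_zero] at h
  have h := hs.norm_image_sub_le_of_norm_hasDerivWithin_le (C := 0) hd (by simp) ha hb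
  rw [zero_mul, norm_le_zero_iff, sub_eq_zero] at h
  exact ((sq_eq_sq₀ (norm_nonneg _) (norm_nonneg _)).1 h).symm

/-- The radial retraction of a normed space onto its closed ball of radius `r`. -/
def radialRetraction {E : Type*} [NormedAddCommGroup E] [NormedSpace ℝ E] (r : ℝ) (y : E) : E :=
  (r / max r ‖y‖) • y

theorem radialRetraction_of_norm_le {E : Type*} [NormedAddCommGroup E] [NormedSpace ℝ E] {r : ℝ}
    (hr : 0 < r) {y : E} (hy : ‖y‖ ≤ r) : radialRetraction r y = y := by
  rw [radialRetraction, max_eq_left hy, div_self hr.ne', one_smul]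

theorem norm_radialRetraction_le {E : Type*} [NormedAddCommGroup E] [NormedSpace ℝ E] {r : ℝ}
    (hr : 0 < r) (y : E) : ‖radialRetraction r y‖ ≤ r := by
  have hm : 0 < max r ‖y‖ := lt_max_of_lt_left hr
  rw [radialRetraction, norm_smul, Real.norm_of_nonneg (by positivity), div_mul_eq_mul_div,
    div_le_iff₀ hm]
  exact mul_le_mul_of_nonneg_left (le_max_right _ _) hr.le

theorem lipschitzWith_radialRetraction {E : Type*} [NormedAddCommGroup E] [NormedSpace ℝ E] {r : ℝ}
    (hr : 0 < r) : LipschitzWith 2 (radialRetraction r : E → E) := by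
  refine LipschitzWith.of_dist_le_mul fun y z => ?_
  rw [dist_eq_norm, dist_eq_norm]
  set a := max r ‖y‖ with ha
  set b := max r ‖z‖ with hb
  have ha0 : 0 < a := lt_max_of_lt_left hr
  have hb0 : 0 < b := lt_max_of_lt_left hr
  have hab : |b - a| ≤ ‖y - z‖ := by
    have h1 := abs_max_sub_max_le_abs ‖z‖ ‖y‖ r
    rw [max_comm _ r, max_comm _ r] at h1
    refine h1.trans ?_
    rw [norm_sub_rev]
    exact abs_norm_sub_norm_le z y
  have hsplit : radialRetraction r y - radialRetraction r z
      = (r / a) • (y - z) + ((r / a) * ((b - a) / b)) • z := by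
    rw [radialRetraction, radialRetraction, ← ha, ← hb,
      show r / a * ((b - a) / b) = r / a - r / b by field_simp]
    module
  have hra : r / a ≤ 1 := (div_le_one ha0).2 (le_max_left _ _)
  have hra0 : 0 ≤ r / a := by positivity
  have hzb : ‖z‖ / b ≤ 1 := (div_le_one hb0).2 (le_max_right _ _)
  rw [hsplit]
  have h1 : ‖(r / a) • (y - z)‖ ≤ ‖y - z‖ := by
    rw [norm_smul, Real.norm_of_nonneg hra0]
    exact mul_le_of_le_one_left (norm_nonneg _) hra
  have h2 : ‖((r / a) * ((b - a) / b)) • z‖ ≤ ‖y - z‖ := by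
    rw [norm_smul, norm_mul, Real.norm_of_nonneg hra0, norm_div, Real.norm_of_nonneg hb0.le,
      Real.norm_eq_abs]
    calc r / a * (|b - a| / b) * ‖z‖ = (r / a) * (‖z‖ / b) * |b - a| := by ring
      _ ≤ 1 * 1 * ‖y - z‖ := by gcongr
      _ = ‖y - z‖ := by ring
  calc _ ≤ ‖y - z‖ + ‖y - z‖ := norm_add_le_of_le h1 h2
    _ = _ := by push_cast; ring

/-- On a compact time interval, a linear equation with skew-symmetric coefficients is solvable. -/
theorem exists_skew_linear_solution_Icc {E : Type*} [NormedAddCommGroup E]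
    [InnerProductSpace ℝ E] [CompleteSpace E] {M : ℝ → E →L[ℝ] E} (hM : Continuous M)
    (hskew : ∀ t y, ⟪y, M t y⟫ = 0) (y₀ : E) {T : ℝ} (hT : 0 ≤ T) :
    ∃ y : ℝ → E, y 0 = y₀ ∧
      ∀ t ∈ Set.Icc (-T) T, HasDerivWithinAt y (M t (y t)) (Set.Icc (-T) T) t := by
  obtain ⟨C, hC⟩ := isCompact_Icc.exists_bound_of_continuousOn (hM.continuousOn (s := Set.Icc (-T) T))
  have hC0 : 0 ≤ C := (norm_nonneg _).trans (hC 0 ⟨by linarith, hT⟩)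
  lift C to ℝ≥0 using hC0
  lift T to ℝ≥0 using hT
  set r : ℝ≥0 := ‖y₀‖₊ + 1 with hr
  have hr0 : (0 : ℝ) < r := by positivity
  have hPL : IsPicardLindelof (fun t y => M t (radialRetraction r y))
      (tmin := -T) (tmax := T) ⟨0, by simp, by simp⟩ y₀ (C * r * T) 0 (C * r) (C * 2) := by
    refine ⟨fun t ht => ?_, fun x _ => ?_, fun t ht x _ => ?_, ?_⟩
    · refine LipschitzWith.lipschitzOnWith ?_
      exact ((M t).lipschitz.weaken (hC t ht)).comp (lipschitzWith_radialRetraction hr0)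
    · exact (hM.clm_apply continuous_const).continuousOn
    · push_cast
      exact ((M t).le_opNorm _).trans
        (mul_le_mul (hC t ht) (norm_radialRetraction_le hr0 _) (norm_nonneg _) C.2)
    · simp
  obtain ⟨y, hy0, hy⟩ := hPL.exists_eq_forall_mem_Icc_hasDerivWithinAt₀
  refine ⟨y, hy0, fun t ht => ?_⟩
  have hnorm : ‖y t‖ = ‖y 0‖ := by
    refine norm_eq_of_inner_deriv_eq_zero (convex_Icc _ _) hy (fun s _ => ?_) ht
      ⟨by simp, by simp⟩
    simp only [radialRetraction, map_smul, inner_smul_right, hskew, mul_zero]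
  have h := hy t ht
  simp only at hy0
  rwa [radialRetraction_of_norm_le hr0] at h
  rw [hnorm, hy0, hr]
  push_cast
  simp

/-- A linear equation with continuous skew-symmetric coefficients is globally solvable. -/
theorem exists_skew_linear_solution {E : Type*} [NormedAddCommGroup E]
    [InnerProductSpace ℝ E] [CompleteSpace E] {M : ℝ → E →L[ℝ] E} (hM : Continuous M)
    (hskew : ∀ t y, ⟪y, M t y⟫ = 0) (y₀ : E) :
    ∃ y : ℝ → E, y 0 = y₀ ∧ ∀ t, HasDerivAt y (M t (y t)) t := by
  have hex := fun n : ℕ => exists_skew_linear_solution_Icc hM hskew y₀ (n.cast_nonneg (α := ℝ))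
  choose Y hY0 hY using hex
  have heq : ∀ (m n : ℕ), m ≤ n → ∀ t ∈ Set.Icc (-(m : ℝ)) m, Y m t = Y n t := by
    intro m n hmn t ht
    have hmn' : (m : ℝ) ≤ n := by exact_mod_cast hmn
    have hsub : Set.Icc (-(m : ℝ)) m ⊆ Set.Icc (-(n : ℝ)) n :=
      Set.Icc_subset_Icc (by linarith) hmn'
    have h := norm_eq_of_inner_deriv_eq_zero (f := fun s => Y m s - Y n s)
      (convex_Icc (-(m : ℝ)) m)
      (fun s hs => (hY m s hs).sub ((hY n s (hsub hs)).mono hsub))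
      (fun s _ => by rw [← map_sub]; exact hskew _ _) ht
      (b := 0) ⟨by simp, by simp⟩
    rw [hY0, hY0, sub_self, norm_zero, norm_eq_zero, sub_eq_zero] at h
    exact h
  refine ⟨fun t => Y (⌈|t|⌉₊ + 1) t, hY0 _, fun t => ?_⟩
  set N : ℕ := ⌈|t|⌉₊ + 2 with hN
  have htN : |t| < (N : ℝ) - 1 := by
    have := Nat.le_ceil |t|
    rw [hN]; push_cast; linarith
  have hmem : Set.Icc (-(N : ℝ)) N ∈ 𝓝 t :=
    Icc_mem_nhds (by linarith [neg_abs_le t]) (by linarith [le_abs_self t])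
  have hev : (fun s => Y (⌈|s|⌉₊ + 1) s) =ᶠ[𝓝 t] Y N := by
    have h1 : ∀ᶠ s in 𝓝 t, |s| < (N : ℝ) - 1 := continuous_abs.continuousAt.eventually_lt_const htN
    filter_upwards [h1] with s hs
    refine heq _ _ ?_ s ?_
    · have : ⌈|s|⌉₊ ≤ ⌈|t|⌉₊ + 1 := by
        rw [Nat.ceil_le]; rw [hN] at hs; push_cast at hs ⊢; linarith
      omega
    · have := Nat.le_ceil |s|
      push_cast
      exact abs_le.1 (by linarith)
  have h := ((hY N t (mem_of_mem_nhds hmem)).hasDerivAt hmem).congr_of_eventuallyEq hev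
  rwa [← hev.self_of_nhds] at h

theorem hasDerivAt_E3_iff {f : ℝ → E3} {f' : E3} {x : ℝ} :
    HasDerivAt f f' x ↔ ∀ i, HasDerivAt (fun y => f y i) (f' i) x := by
  simp only [hasDerivAt_iff_hasFDerivAt, ← hasFDerivWithinAt_univ]
  rw [hasFDerivWithinAt_euclidean]
  refine forall_congr' fun i => ?_
  rw [show (PiLp.proj 2 (fun _ : Fin 3 => ℝ) i ∘L ContinuousLinearMap.toSpanSingleton ℝ f')
    = ContinuousLinearMap.toSpanSingleton ℝ (f' i) by ext; simp]

theorem E3_ext {a b : E3} (h0 : a 0 = b 0) (h1 : a 1 = b 1) (h2 : a 2 = b 2) : a = b := by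
  ext i
  fin_cases i <;> assumption

theorem cross_zero (a b : E3) : cross a b 0 = a 1 * b 2 - a 2 * b 1 := rfl
theorem cross_one (a b : E3) : cross a b 1 = a 2 * b 0 - a 0 * b 2 := rfl
theorem cross_two (a b : E3) : cross a b 2 = a 0 * b 1 - a 1 * b 0 := rfl

theorem inner_E3 (a b : E3) : ⟪a, b⟫ = a 0 * b 0 + a 1 * b 1 + a 2 * b 2 := by
  simp [PiLp.inner_apply, Fin.sum_univ_three]
  ring

theorem norm_sq_E3 (a : E3) : ‖a‖ ^ 2 = a 0 ^ 2 + a 1 ^ 2 + a 2 ^ 2 := by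
  rw [← real_inner_self_eq_norm_sq, inner_E3]
  ring

/-- `(u, v, w)` is a scalar solution of the Serret–Frenet system of curvature `κ` and
torsion `τ`. -/
def IsFrenet (κ τ u v w : ℝ → ℝ) : Prop :=
  ∀ x, HasDerivAt u (κ x * v x) x ∧ HasDerivAt v (-κ x * u x + τ x * w x) x ∧
    HasDerivAt w (-τ x * v x) x

/-- The curvature `c e^{-αx²/4}`. -/
def curvature (α c x : ℝ) : ℝ := c * Real.exp (-α * x ^ 2 / 4)

/-- The torsion `βx/2`. -/
def torsion (β x : ℝ) : ℝ := β * x / 2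

theorem IsFrenet.dot_eq {κ τ u v w u' v' w' : ℝ → ℝ} (h : IsFrenet κ τ u v w)
    (h' : IsFrenet κ τ u' v' w') (x : ℝ) :
    u x * u' x + v x * v' x + w x * w' x = u 0 * u' 0 + v 0 * v' 0 + w 0 * w' 0 := by
  have hd : ∀ x, HasDerivAt (fun x => u x * u' x + v x * v' x + w x * w' x) 0 x := fun x => by
    obtain ⟨h1, h2, h3⟩ := h x
    obtain ⟨h1', h2', h3'⟩ := h' x
    refine (((h1.mul h1').add (h2.mul h2')).add (h3.mul h3')).congr_deriv ?_
    ring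
  exact is_const_of_deriv_eq_zero (fun x => (hd x).differentiableAt) (fun x => (hd x).deriv) x 0

theorem IsFrenet.sub {κ τ u v w u' v' w' : ℝ → ℝ} (h : IsFrenet κ τ u v w)
    (h' : IsFrenet κ τ u' v' w') :
    IsFrenet κ τ (fun x => u x - u' x) (fun x => v x - v' x) (fun x => w x - w' x) := by
  intro x
  obtain ⟨h1, h2, h3⟩ := h x
  obtain ⟨h1', h2', h3'⟩ := h' x
  exact ⟨(h1.sub h1').congr_deriv (by ring), (h2.sub h2').congr_deriv (by ring),
    (h3.sub h3').congr_deriv (by ring)⟩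

theorem IsFrenet.unique {κ τ u v w u' v' w' : ℝ → ℝ} (h : IsFrenet κ τ u v w)
    (h' : IsFrenet κ τ u' v' w') (hu : u 0 = u' 0) (hv : v 0 = v' 0) (hw : w 0 = w' 0) (x : ℝ) :
    u x = u' x ∧ v x = v' x ∧ w x = w' x := by
  have hs := (h.sub h').dot_eq (h.sub h') x
  simp only [hu, hv, hw, sub_self, mul_zero, add_zero] at hs
  refine ⟨?_, ?_, ?_⟩ <;>
    nlinarith [sq_nonneg (u x - u' x), sq_nonneg (v x - v' x), sq_nonneg (w x - w' x)]

/-- The generator of the rotation of the Serret–Frenet frame caused by curvature. -/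
def curvatureGen : E3 →L[ℝ] E3 :=
  LinearMap.toContinuousLinearMap
    { toFun := fun y => toE3 ![y 1, -y 0, 0]
      map_add' := fun a b => by
        apply E3_ext <;> simp [toE3, add_comm]
      map_smul' := fun a b => by
        apply E3_ext <;> simp [toE3] }

/-- The generator of the rotation of the Serret–Frenet frame caused by torsion. -/
def torsionGen : E3 →L[ℝ] E3 :=
  LinearMap.toContinuousLinearMap
    { toFun := fun y => toE3 ![0, y 2, -y 1]
      map_add' := fun a b => by
        apply E3_ext <;> simp [toE3, add_comm]
      map_smul' := fun a b => by
        apply E3_ext <;> simp [toE3] }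

theorem curvatureGen_apply (y : E3) : curvatureGen y = toE3 ![y 1, -y 0, 0] := rfl
theorem torsionGen_apply (y : E3) : torsionGen y = toE3 ![0, y 2, -y 1] := rfl

theorem exists_isFrenet {κ τ : ℝ → ℝ} (hκ : Continuous κ) (hτ : Continuous τ) (y₀ : E3) :
    ∃ y : ℝ → E3, y 0 = y₀ ∧
      IsFrenet κ τ (fun x => y x 0) (fun x => y x 1) (fun x => y x 2) := by
  obtain ⟨y, hy0, hy⟩ := exists_skew_linear_solution
    (M := fun x => κ x • curvatureGen + τ x • torsionGen) (by fun_prop)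
    (fun x y => by
      simp [inner_E3, curvatureGen_apply, torsionGen_apply, toE3]
      ring) y₀
  refine ⟨y, hy0, fun x => ?_⟩
  have h := hasDerivAt_E3_iff.1 (hy x)
  refine ⟨(h 0).congr_deriv ?_, (h 1).congr_deriv ?_, (h 2).congr_deriv ?_⟩ <;>
    simp [curvatureGen_apply, torsionGen_apply, toE3]

theorem continuous_curvature (α c : ℝ) : Continuous (curvature α c) := by
  unfold curvature
  fun_prop

theorem continuous_torsion (β : ℝ) : Continuous (torsion β) := by
  unfold torsion
  fun_prop

theorem IsSF.isFrenet {α β c : ℝ} {m n b : ℝ → E3} (h : IsSF α β c m n b) (i : Fin 3) :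
    IsFrenet (curvature α c) (torsion β) (fun x => m x i) (fun x => n x i) (fun x => b x i) := by
  obtain ⟨hm, hn, hb, -⟩ := h
  intro x
  exact ⟨hasDerivAt_E3_iff.1 (hm x) i, hasDerivAt_E3_iff.1 (hn x) i,
    hasDerivAt_E3_iff.1 (hb x) i⟩

theorem exists_isSF (α β c : ℝ) : ∃ m n b, IsSF α β c m n b := by
  have hex := fun i : Fin 3 => exists_isFrenet (continuous_curvature α c) (continuous_torsion β)
    (EuclideanSpace.single i 1)
  choose y hy0 hy using hex
  refine ⟨fun x => toE3 fun i => y i x 0, fun x => toE3 fun i => y i x 1,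
    fun x => toE3 fun i => y i x 2, fun x => hasDerivAt_E3_iff.2 fun i => (hy i x).1,
    fun x => hasDerivAt_E3_iff.2 fun i => (hy i x).2.1,
    fun x => hasDerivAt_E3_iff.2 fun i => (hy i x).2.2, ?_, ?_, ?_⟩ <;>
  · ext i
    fin_cases i <;> simp [toE3, hy0, e1, e2, e3]

theorem IsSF.unique {α β c : ℝ} {m n b m' n' b' : ℝ → E3} (h : IsSF α β c m n b)
    (h' : IsSF α β c m' n' b') : m = m' ∧ n = n' ∧ b = b' := by
  have key := fun i : Fin 3 => (h.isFrenet i).unique (h'.isFrenet i)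
    (by rw [h.2.2.2.1, h'.2.2.2.1]) (by rw [h.2.2.2.2.1, h'.2.2.2.2.1])
    (by rw [h.2.2.2.2.2, h'.2.2.2.2.2])
  exact ⟨funext fun x => PiLp.ext fun i => (key i x).1,
    funext fun x => PiLp.ext fun i => (key i x).2.1,
    funext fun x => PiLp.ext fun i => (key i x).2.2⟩

theorem e1_apply (i : Fin 3) : e1 i = if i = 0 then 1 else 0 := by
  simp [e1]
theorem e2_apply (i : Fin 3) : e2 i = if i = 1 then 1 else 0 := by
  simp [e2]
theorem e3_apply (i : Fin 3) : e3 i = if i = 2 then 1 else 0 := by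
  simp [e3]

theorem hasDerivAt_cross {f g : ℝ → E3} {f' g' : E3} {x : ℝ} (hf : HasDerivAt f f' x)
    (hg : HasDerivAt g g' x) :
    HasDerivAt (fun y => cross (f y) (g y)) (cross f' (g x) + cross (f x) g') x := by
  have hf' := hasDerivAt_E3_iff.1 hf
  have hg' := hasDerivAt_E3_iff.1 hg
  refine hasDerivAt_E3_iff.2 fun i => ?_
  fin_cases i
  · refine (((hf' 1).mul (hg' 2)).sub ((hf' 2).mul (hg' 1))).congr_deriv ?_
    simp [cross_zero]
    ring
  · refine (((hf' 2).mul (hg' 0)).sub ((hf' 0).mul (hg' 2))).congr_deriv ?_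
    simp [cross_one]
    ring
  · refine (((hf' 0).mul (hg' 1)).sub ((hf' 1).mul (hg' 0))).congr_deriv ?_
    simp [cross_two]
    ring

theorem IsSF.cross_isSF {α β c : ℝ} {m n b : ℝ → E3} (h : IsSF α β c m n b) :
    IsSF α β c (fun x => cross (n x) (b x)) (fun x => cross (b x) (m x))
      (fun x => cross (m x) (n x)) := by
  obtain ⟨hm, hn, hb, hm0, hn0, hb0⟩ := h
  refine ⟨fun x => (hasDerivAt_cross (hn x) (hb x)).congr_deriv ?_,
    fun x => (hasDerivAt_cross (hb x) (hm x)).congr_deriv ?_,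
    fun x => (hasDerivAt_cross (hm x) (hn x)).congr_deriv ?_, ?_, ?_, ?_⟩
  rotate_right 3
  all_goals
    apply E3_ext <;>
    simp [cross_zero, cross_one, cross_two, hm0, hn0, hb0, e1_apply, e2_apply, e3_apply] <;> ring

/-- Reflecting the parameter amounts to a half-turn about the first axis. -/
theorem IsSF.reflect {α β c : ℝ} {m n b : ℝ → E3} (h : IsSF α β c m n b) (x : ℝ) :
    m (-x) = toE3 ![m x 0, -m x 1, -m x 2] := by
  have key : ∀ (i : Fin 3) (s : ℝ), IsFrenet (curvature α c) (torsion β) (fun x => s * m (-x) i)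
      (fun x => -(s * n (-x) i)) (fun x => -(s * b (-x) i)) := by
    intro i s x
    obtain ⟨h1, h2, h3⟩ := h.isFrenet i (-x)
    have hneg := hasDerivAt_neg x
    have hk : curvature α c (-x) = curvature α c x := by simp [curvature]
    have ht : torsion β (-x) = -torsion β x := by simp [torsion, neg_div]
    rw [hk] at h1 h2
    rw [ht] at h2 h3
    exact ⟨((h1.comp x hneg).const_mul s).congr_deriv (by ring),
      ((h2.comp x hneg).const_mul s).neg.congr_deriv (by ring),
      ((h3.comp x hneg).const_mul s).neg.congr_deriv (by ring)⟩
  obtain ⟨-, -, -, hm0, hn0, hb0⟩ := id h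
  have h0 := ((key 0 1).unique (h.isFrenet 0) (by simp) (by simp [hn0, e2_apply])
    (by simp [hb0, e3_apply]) x).1
  have h1 := ((key 1 (-1)).unique (h.isFrenet 1) (by simp [hm0, e1_apply]) (by simp)
    (by simp [hb0, e3_apply]) x).1
  have h2 := ((key 2 (-1)).unique (h.isFrenet 2) (by simp [hm0, e1_apply])
    (by simp [hn0, e2_apply]) (by simp) x).1
  apply E3_ext <;> simp [toE3] <;> linarith

/-- A moving frame, in arbitrary initial position, of curvature `c e^{-αx²/4}` and torsion
`βx/2`. -/
structure IsMovingFrame (α β c : ℝ) (m n b : ℝ → E3) : Prop where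
  hasDerivAt_m : ∀ x, HasDerivAt m (curvature α c x • n x) x
  hasDerivAt_n : ∀ x, HasDerivAt n (-curvature α c x • m x + torsion β x • b x) x
  hasDerivAt_b : ∀ x, HasDerivAt b (-torsion β x • n x) x
  cross_m_n : ∀ x, cross (m x) (n x) = b x
  cross_b_m : ∀ x, cross (b x) (m x) = n x
  norm_n : ∀ x, ‖n x‖ = 1

theorem IsSF.cross_eq {α β c : ℝ} {m n b : ℝ → E3} (h : IsSF α β c m n b) (x : ℝ) :
    cross (n x) (b x) = m x ∧ cross (b x) (m x) = n x ∧ cross (m x) (n x) = b x := by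
  obtain ⟨hm, hn, hb⟩ := h.cross_isSF.unique h
  exact ⟨congrFun hm x, congrFun hn x, congrFun hb x⟩

theorem inner_cross_rotate (a b c : E3) : ⟪cross a b, c⟫ = ⟪cross b c, a⟫ := by
  simp only [inner_E3, cross_zero, cross_one, cross_two]
  ring

theorem IsSF.row_norm {α β c : ℝ} {m n b : ℝ → E3} (h : IsSF α β c m n b) (i : Fin 3) (x : ℝ) :
    m x i ^ 2 + n x i ^ 2 + b x i ^ 2 = 1 := by
  have hi := (h.isFrenet i).dot_eq (h.isFrenet i) x
  simp only [h.2.2.2.1, h.2.2.2.2.1, h.2.2.2.2.2, e1_apply, e2_apply, e3_apply] at hi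
  rw [pow_two, pow_two, pow_two, hi]
  fin_cases i <;> simp

theorem IsSF.norm_eq {α β c : ℝ} {m n b : ℝ → E3} (h : IsSF α β c m n b) (x : ℝ) :
    ‖m x‖ = 1 ∧ ‖n x‖ = 1 := by
  obtain ⟨h1, h2, h3⟩ := h.cross_eq x
  have hmn : ‖m x‖ ^ 2 = ‖n x‖ ^ 2 := by
    have := inner_cross_rotate (n x) (b x) (m x)
    rwa [h1, h2, real_inner_self_eq_norm_sq, real_inner_self_eq_norm_sq] at this
  have hnb : ‖n x‖ ^ 2 = ‖b x‖ ^ 2 := by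
    have := inner_cross_rotate (b x) (m x) (n x)
    rwa [h2, h3, real_inner_self_eq_norm_sq, real_inner_self_eq_norm_sq] at this
  have hsum : ‖m x‖ ^ 2 + ‖n x‖ ^ 2 + ‖b x‖ ^ 2 = 3 := by
    rw [norm_sq_E3, norm_sq_E3, norm_sq_E3]
    linarith [h.row_norm 0 x, h.row_norm 1 x, h.row_norm 2 x]
  constructor <;> refine (sq_eq_sq₀ (norm_nonneg _) zero_le_one).1 ?_ <;> linarith

theorem IsSF.isMovingFrame {α β c : ℝ} {m n b : ℝ → E3} (h : IsSF α β c m n b) :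
    IsMovingFrame α β c m n b :=
  ⟨h.1, h.2.1, h.2.2.1, fun x => (h.cross_eq x).2.2, fun x => (h.cross_eq x).2.1,
    fun x => (h.norm_eq x).2⟩

theorem inner_cross_eq_det (a b c : E3) :
    ⟪cross a b, c⟫ = (EuclideanSpace.basisFun (Fin 3) ℝ).toBasis.det ![a, b, c] := by
  rw [Module.Basis.det_apply, Matrix.det_fin_three, inner_E3]
  simp [Module.Basis.toMatrix_apply, cross_zero, cross_one, cross_two]
  ring

theorem IsRotation.map_cross {R : E3 ≃ₗᵢ[ℝ] E3} (hR : IsRotation R) (a b : E3) :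
    R (cross a b) = cross (R a) (R b) := by
  refine ext_inner_right ℝ fun v => ?_
  obtain ⟨v, rfl⟩ := R.surjective v
  have h := Module.Basis.det_comp (EuclideanSpace.basisFun (Fin 3) ℝ).toBasis
    (R.toLinearEquiv : E3 →ₗ[ℝ] E3) ![a, b, v]
  rw [hR, one_mul] at h
  rw [R.inner_map_map, inner_cross_eq_det, inner_cross_eq_det, ← h]
  congr 1
  ext i
  fin_cases i <;> rfl

theorem IsMovingFrame.rotate {α β c : ℝ} {m n b : ℝ → E3} (h : IsMovingFrame α β c m n b)
    {R : E3 ≃ₗᵢ[ℝ] E3} (hR : IsRotation R) :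
    IsMovingFrame α β c (fun x => R (m x)) (fun x => R (n x)) (fun x => R (b x)) := by
  have hd : ∀ {f : ℝ → E3} {f' : E3} {x : ℝ}, HasDerivAt f f' x →
      HasDerivAt (fun y => R (f y)) (R f') x := fun hf =>
    (R.toContinuousLinearEquiv : E3 →L[ℝ] E3).hasFDerivAt.comp_hasDerivAt _ hf
  refine ⟨fun x => (hd (h.hasDerivAt_m x)).congr_deriv (by simp),
    fun x => (hd (h.hasDerivAt_n x)).congr_deriv (by simp),
    fun x => (hd (h.hasDerivAt_b x)).congr_deriv (by simp), fun x => ?_, fun x => ?_, fun x => ?_⟩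
  · rw [← hR.map_cross, h.cross_m_n]
  · rw [← hR.map_cross, h.cross_b_m]
  · rw [R.norm_map, h.norm_n]

theorem contDiff_curvature {N : WithTop ℕ∞} (α c : ℝ) : ContDiff ℝ N (curvature α c) := by
  unfold curvature
  fun_prop

theorem contDiff_torsion {N : WithTop ℕ∞} (β : ℝ) : ContDiff ℝ N (torsion β) := by
  unfold torsion
  fun_prop

theorem IsMovingFrame.contDiff {α β c : ℝ} {m n b : ℝ → E3} (h : IsMovingFrame α β c m n b) :
    ContDiff ℝ (⊤ : ℕ∞) m := by
  suffices H : ∀ N : ℕ, ContDiff ℝ N m ∧ ContDiff ℝ N n ∧ ContDiff ℝ N b from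
    contDiff_infty.2 fun N => (H N).1
  have hdm : Differentiable ℝ m := fun x => (h.hasDerivAt_m x).differentiableAt
  have hdn : Differentiable ℝ n := fun x => (h.hasDerivAt_n x).differentiableAt
  have hdb : Differentiable ℝ b := fun x => (h.hasDerivAt_b x).differentiableAt
  intro N
  induction N with
  | zero => exact ⟨contDiff_zero.2 hdm.continuous, contDiff_zero.2 hdn.continuous,
      contDiff_zero.2 hdb.continuous⟩
  | succ N ih =>
    obtain ⟨hm, hn, hb⟩ := ih
    push_cast
    refine ⟨contDiff_succ_iff_deriv.2 ⟨hdm, by simp, ?_⟩,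
      contDiff_succ_iff_deriv.2 ⟨hdn, by simp, ?_⟩, contDiff_succ_iff_deriv.2 ⟨hdb, by simp, ?_⟩⟩
    · rw [funext fun x => (h.hasDerivAt_m x).deriv]
      exact (contDiff_curvature α c).smul hn
    · rw [funext fun x => (h.hasDerivAt_n x).deriv]
      exact ((contDiff_curvature α c).neg.smul hm).add ((contDiff_torsion β).smul hb)
    · rw [funext fun x => (h.hasDerivAt_b x).deriv]
      exact (contDiff_torsion β).neg.smul hn

theorem hasDerivAt_curvature (α c x : ℝ) :
    HasDerivAt (curvature α c) (-(α * x / 2) * curvature α c x) x := by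
  have h : HasDerivAt (fun x : ℝ => -α * x ^ 2 / 4) (-(α * x / 2)) x :=
    ((((hasDerivAt_id x).pow 2).const_mul (-α)).div_const 4).congr_deriv (by simp; ring)
  exact (h.exp.const_mul c).congr_deriv (by rw [curvature]; ring)

theorem cross_linear_combination (m n b : E3) (p q r : ℝ) :
    cross m (p • n + q • m + r • b) = p • cross m n - r • cross b m := by
  apply E3_ext <;> simp [cross_zero, cross_one, cross_two] <;> ring

theorem IsMovingFrame.hasDerivAt_scaled {α β c : ℝ} {m n b : ℝ → E3}
    (h : IsMovingFrame α β c m n b) (a x : ℝ) :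
    HasDerivAt (fun y => m (y / a)) (a⁻¹ • (curvature α c (x / a) • n (x / a))) x := by
  have hd : HasDerivAt (fun y : ℝ => y / a) a⁻¹ x :=
    ((hasDerivAt_id x).div_const a).congr_deriv (by simp)
  exact (h.hasDerivAt_m (x / a)).scomp x hd

theorem IsMovingFrame.deriv_deriv_scaled {α β c : ℝ} {m n b : ℝ → E3}
    (h : IsMovingFrame α β c m n b) (a x : ℝ) :
    deriv (deriv fun y => m (y / a)) x =
      (-(a⁻¹ ^ 2 * (α * (x / a) / 2 * curvature α c (x / a)))) • n (x / a)
        + (-(a⁻¹ ^ 2 * curvature α c (x / a) ^ 2)) • m (x / a)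
        + (a⁻¹ ^ 2 * (curvature α c (x / a) * torsion β (x / a))) • b (x / a) := by
  have hd : HasDerivAt (fun y : ℝ => y / a) a⁻¹ x :=
    ((hasDerivAt_id x).div_const a).congr_deriv (by simp)
  rw [funext fun x => (h.hasDerivAt_scaled a x).deriv]
  have h2 := (((hasDerivAt_curvature α c (x / a)).smul (h.hasDerivAt_n (x / a))).scomp x
    hd).const_smul a⁻¹
  rw [HasDerivAt.deriv (f := fun x => a⁻¹ • curvature α c (x / a) • n (x / a)) h2]
  module

theorem IsMovingFrame.landau_lifshitz {α β c : ℝ} {m n b : ℝ → E3}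
    (h : IsMovingFrame α β c m n b) (hαβ : α ^ 2 + β ^ 2 = 1) (x : ℝ) {t : ℝ} (ht : 0 < t) :
    deriv (fun s => m (x / Real.sqrt s)) t =
      β • cross (m (x / Real.sqrt t)) (deriv (deriv (fun y => m (y / Real.sqrt t))) x)
        - α • cross (m (x / Real.sqrt t)) (cross (m (x / Real.sqrt t))
            (deriv (deriv (fun y => m (y / Real.sqrt t))) x)) := by
  have hst : 0 < √t := Real.sqrt_pos.2 ht
  have hd : HasDerivAt (fun s => x / √s) (-((√t)⁻¹ ^ 2 * (x / √t) / 2)) t :=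
    ((hasDerivAt_const t x).div (Real.hasDerivAt_sqrt ht.ne') hst.ne').congr_deriv (by
      field_simp
      ring)
  rw [HasDerivAt.deriv (f := fun s => m (x / √s)) ((h.hasDerivAt_m (x / √t)).scomp t hd),
    h.deriv_deriv_scaled, cross_linear_combination, h.cross_m_n, h.cross_b_m]
  set a := (√t)⁻¹
  set s := x / √t
  set κ := curvature α c s
  have hτ : torsion β s = β * s / 2 := rfl
  have hcomb := cross_linear_combination (m s) (n s) (b s) (-(a ^ 2 * (κ * torsion β s))) 0
    (-(a ^ 2 * (α * s / 2 * κ)))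
  rw [h.cross_m_n, h.cross_b_m, zero_smul, add_zero] at hcomb
  rw [show (-(a ^ 2 * (α * s / 2 * κ))) • b s - (a ^ 2 * (κ * torsion β s)) • n s =
    (-(a ^ 2 * (κ * torsion β s))) • n s + (-(a ^ 2 * (α * s / 2 * κ))) • b s by module,
    hcomb, hτ, show (-(a ^ 2 * s / 2)) • κ • n s
      = (α ^ 2 + β ^ 2) • (-(a ^ 2 * s / 2)) • κ • n s by rw [hαβ, one_smul]]
  module

theorem curvature_nonneg {α c : ℝ} (hc : 0 ≤ c) (x : ℝ) : 0 ≤ curvature α c x := by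
  unfold curvature
  positivity

theorem IsMovingFrame.sqrt_mul_iSup {α β c : ℝ} {m n b : ℝ → E3}
    (h : IsMovingFrame α β c m n b) (hα : 0 ≤ α) (hc : 0 ≤ c) {t : ℝ} (ht : 0 < t) :
    √t * (⨆ x : ℝ, ‖deriv (fun y => m (y / √t)) x‖) = c := by
  have hst : 0 < √t := Real.sqrt_pos.2 ht
  have hval : ∀ x, ‖deriv (fun y => m (y / √t)) x‖ = (√t)⁻¹ * curvature α c (x / √t) := by
    intro x
    rw [(h.hasDerivAt_scaled _ x).deriv, norm_smul, norm_smul, h.norm_n, mul_one,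
      Real.norm_of_nonneg (by positivity), Real.norm_of_nonneg (curvature_nonneg hc _)]
  have hle : ∀ x, (√t)⁻¹ * curvature α c (x / √t) ≤ (√t)⁻¹ * c := by
    intro x
    refine mul_le_mul_of_nonneg_left (mul_le_of_le_one_right hc (Real.exp_le_one_iff.2 ?_))
      (by positivity)
    have : 0 ≤ α * (x / √t) ^ 2 := by positivity
    linarith
  have hsup : (⨆ x : ℝ, (√t)⁻¹ * curvature α c (x / √t)) = (√t)⁻¹ * c := by
    refine le_antisymm (ciSup_le hle) ?_
    refine le_trans (le_of_eq ?_) (le_ciSup ⟨_, Set.forall_mem_range.2 hle⟩ 0)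
    simp [curvature]
  simp only [hval]
  rw [hsup, mul_inv_cancel_left₀ hst.ne']

theorem tendsto_const_div_sqrt_atTop {x : ℝ} (hx : 0 < x) :
    Tendsto (fun t => x / √t) (𝓝[>] 0) atTop := by
  refine Tendsto.const_mul_atTop hx (tendsto_inv_nhdsGT_zero.comp ?_)
  refine tendsto_nhdsWithin_iff.2 ⟨?_, ?_⟩
  · have h := Real.continuous_sqrt.tendsto 0
    rw [Real.sqrt_zero] at h
    exact h.mono_left nhdsWithin_le_nhds
  · filter_upwards [self_mem_nhdsWithin] with t ht using Real.sqrt_pos.2 ht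

theorem IsSF.isSelfSimSolution {α β c : ℝ} {m n b : ℝ → E3} (h : IsSF α β c m n b)
    (hα : 0 ≤ α) (hαβ : α ^ 2 + β ^ 2 = 1) (hc : 0 ≤ c) {A A' : E3}
    (hA : Tendsto m atTop (𝓝 A)) (hA' : Tendsto m atBot (𝓝 A'))
    {R : E3 ≃ₗᵢ[ℝ] E3} (hR : IsRotation R) :
    IsSelfSimSolution α β c R (R A) (R A') := by
  intro m' n' b' h'
  obtain ⟨rfl, -, -⟩ := h.unique h'
  have hf := h.isMovingFrame.rotate hR
  refine ⟨?_, fun x t ht => hf.landau_lifshitz hαβ x ht, fun x hx => ?_, fun x hx => ?_,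
    fun t ht => hf.sqrt_mul_iSup hα hc ht⟩
  · refine hf.contDiff.comp_contDiffOn (f := fun p : ℝ × ℝ => p.1 / √p.2) ?_
    have hpos : ∀ p ∈ (Set.univ : Set ℝ) ×ˢ Set.Ioi (0 : ℝ), p.2 ≠ 0 := fun p hp =>
      (Set.mem_Ioi.1 hp.2).ne'
    exact contDiff_fst.contDiffOn.div (contDiff_snd.contDiffOn.sqrt hpos) fun p hp =>
      (Real.sqrt_pos.2 (Set.mem_Ioi.1 hp.2)).ne'
  · exact (R.continuous.tendsto A).comp (hA.comp (tendsto_const_div_sqrt_atTop hx))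
  · refine (R.continuous.tendsto A').comp (hA'.comp ?_)
    have h := tendsto_neg_atTop_atBot.comp (tendsto_const_div_sqrt_atTop (neg_pos.2 hx))
    refine h.congr fun t => ?_
    simp [neg_div]

theorem exists_orthonormalBasis_of_unit_pair {a a' : E3} (ha : ‖a‖ = 1) (ha' : ‖a'‖ = 1) :
    ∃ b : OrthonormalBasis (Fin 3) ℝ E3, b 0 = a ∧
      a' = ⟪a, a'⟫ • a + √(1 - ⟪a, a'⟫ ^ 2) • b 1 := by
  have haa : ⟪a, a⟫ = 1 := by rw [real_inner_self_eq_norm_sq, ha, one_pow]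
  have haa' : ⟪a', a'⟫ = 1 := by rw [real_inner_self_eq_norm_sq, ha', one_pow]
  set w := a' - ⟪a, a'⟫ • a with hw
  have haw : ⟪a, w⟫ = 0 := by
    rw [hw, inner_sub_right, inner_smul_right, haa, mul_one, sub_self]
  have hwn : √(1 - ⟪a, a'⟫ ^ 2) = ‖w‖ := by
    rw [← Real.sqrt_sq (norm_nonneg w)]
    congr 1
    rw [← real_inner_self_eq_norm_sq, hw, inner_sub_left, ← hw, real_inner_smul_left, haw, hw,
      inner_sub_right, inner_smul_right, haa', real_inner_comm a a']
    ring
  have hcard : Module.finrank ℝ E3 = Fintype.card (Fin 3) := by simp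
  rw [hwn]
  by_cases h0 : w = 0
  · have hv : Orthonormal ℝ (({0} : Set (Fin 3)).domRestrict ![a, 0, 0]) := by
      refine ⟨?_, ?_⟩
      · rintro ⟨i, rfl⟩
        simpa using ha
      · rintro ⟨i, rfl⟩ ⟨j, rfl⟩ hij
        exact absurd rfl hij
    obtain ⟨b, hb⟩ := hv.exists_orthonormalBasis_extension_of_card_eq hcard
    refine ⟨b, by simpa using hb 0 rfl, ?_⟩
    rw [h0, norm_zero, zero_smul, add_zero]
    exact sub_eq_zero.1 h0
  · have hwpos : 0 < ‖w‖ := norm_pos_iff.2 h0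
    have hun : ‖‖w‖⁻¹ • w‖ = 1 := by
      rw [norm_smul, norm_inv, norm_norm, inv_mul_cancel₀ hwpos.ne']
    have horth : ⟪a, ‖w‖⁻¹ • w⟫ = 0 := by rw [inner_smul_right, haw, mul_zero]
    have horth' : ⟪‖w‖⁻¹ • w, a⟫ = 0 := by rw [real_inner_comm, horth]
    have hv : Orthonormal ℝ (({0, 1} : Set (Fin 3)).domRestrict ![a, ‖w‖⁻¹ • w, 0]) := by
      refine ⟨?_, ?_⟩
      · rintro ⟨i, rfl | rfl⟩
        · exact ha
        · exact hun
      · rintro ⟨i, rfl | rfl⟩ ⟨j, rfl | rfl⟩ hij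
        · exact absurd rfl hij
        · exact horth
        · exact horth'
        · exact absurd rfl hij
    obtain ⟨b, hb⟩ := hv.exists_orthonormalBasis_extension_of_card_eq hcard
    refine ⟨b, by simpa using hb 0 (by simp), ?_⟩
    have hb1 : b 1 = ‖w‖⁻¹ • w := by simpa using hb 1 (by simp)
    rw [hb1, smul_inv_smul₀ hwpos.ne', hw]
    abel

theorem exists_isRotation {a a' p p' : E3} (ha : ‖a‖ = 1) (ha' : ‖a'‖ = 1) (hp : ‖p‖ = 1)
    (hp' : ‖p'‖ = 1) (h : ⟪a, a'⟫ = ⟪p, p'⟫) :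
    ∃ R : E3 ≃ₗᵢ[ℝ] E3, IsRotation R ∧ R a = p ∧ R a' = p' := by
  obtain ⟨b, hb0, hb⟩ := exists_orthonormalBasis_of_unit_pair ha ha'
  obtain ⟨d, hd0, hd⟩ := exists_orthonormalBasis_of_unit_pair hp hp'
  have hmap : ∀ R : E3 ≃ₗᵢ[ℝ] E3, R (b 0) = d 0 → R (b 1) = d 1 → R a = p ∧ R a' = p' := by
    intro R h0 h1
    refine ⟨by rw [← hb0, h0, hd0], ?_⟩
    rw [hb, map_add, map_smul, map_smul, h1, ← hb0, h0, hb0, hd0, h, ← hd]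
  set R := b.equiv d (Equiv.refl _) with hRdef
  have hRi : ∀ i, R (b i) = d i := fun i => by simp [hRdef]
  have hdet : |LinearMap.det (R.toLinearEquiv : E3 →ₗ[ℝ] E3)| = 1 := by
    rw [← LinearMap.normDet_eq_abs_det]
    exact R.toLinearIsometry.normDet_eq_one
  rcases eq_or_eq_neg_of_abs_eq hdet with h1 | h1
  · exact ⟨R, h1, hmap R (hRi 0) (hRi 1)⟩
  · set S : E3 ≃ₗᵢ[ℝ] E3 := (ℝ ∙ d 2)ᗮ.reflection with hS
    have hS0 : ∀ i, i ≠ 2 → S (d i) = d i := fun i hi =>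
      Submodule.reflection_mem_subspace_eq_self
        (Submodule.mem_orthogonal_singleton_iff_inner_right.2 (d.orthonormal.2 hi.symm))
    refine ⟨R.trans S, ?_, hmap _ ?_ ?_⟩
    · have hSdet : LinearMap.det (S.toLinearEquiv : E3 →ₗ[ℝ] E3) = -1 := by
        have := Submodule.det_reflection (ℝ ∙ d 2)ᗮ
        rw [Submodule.orthogonal_orthogonal, finrank_span_singleton (d.orthonormal.ne_zero 2),
          pow_one] at this
        exact this
      have hcomp : ((R.trans S).toLinearEquiv : E3 →ₗ[ℝ] E3)
          = (S.toLinearEquiv : E3 →ₗ[ℝ] E3) ∘ₗ (R.toLinearEquiv : E3 →ₗ[ℝ] E3) := rfl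
      rw [IsRotation, hcomp, LinearMap.det_comp, hSdet, h1]
      norm_num
    · simp [hRi, hS0]
    · simp [hRi, hS0]

theorem integrable_curvature {α : ℝ} (hα : 0 < α) (c : ℝ) : Integrable (curvature α c) := by
  refine ((integrable_exp_neg_mul_sq (b := α / 4) (by positivity)).const_mul c).congr ?_
  refine Eventually.of_forall fun x => ?_
  simp only [curvature]
  ring_nf

theorem IsSF.exists_tendsto {α β c : ℝ} {m n b : ℝ → E3} (h : IsSF α β c m n b) (hα : 0 < α) :
    ∃ A, Tendsto m atTop (𝓝 A) := by
  refine ⟨_, tendsto_limUnder_of_hasDerivAt_of_integrableOn_Ioi (a := 0) (fun x _ => h.1 x) ?_⟩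
  have hn : Continuous n :=
    continuous_iff_continuousAt.2 fun x => (h.isMovingFrame.hasDerivAt_n x).continuousAt
  refine Integrable.integrableOn ((integrable_curvature hα c).norm.mono'
    ((continuous_curvature α c).smul hn).aestronglyMeasurable (Eventually.of_forall fun x => ?_))
  rw [norm_smul, (h.norm_eq x).2, mul_one]
  exact le_rfl

/-- The half-turn about the first axis. -/
def halfTurn : E3 →L[ℝ] E3 :=
  LinearMap.toContinuousLinearMap
    { toFun := fun y => toE3 ![y 0, -y 1, -y 2]
      map_add' := fun a b => by
        apply E3_ext <;> simp [toE3, add_comm]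
      map_smul' := fun a b => by
        apply E3_ext <;> simp [toE3] }

theorem halfTurn_apply (y : E3) : halfTurn y = toE3 ![y 0, -y 1, -y 2] := rfl

theorem IsSF.exists_isSelfSimSolution {α β c : ℝ} {m n b : ℝ → E3} (h : IsSF α β c m n b)
    (hα : 0 < α) (hαβ : α ^ 2 + β ^ 2 = 1) (hc : 0 ≤ c) {a : ℝ}
    (ha : Tendsto (fun x => m x 0) atTop (𝓝 a)) {Ap Am : E3} (hAp : ‖Ap‖ = 1) (hAm : ‖Am‖ = 1)
    (hangle : 2 * a ^ 2 - 1 = ⟪Ap, Am⟫) :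
    ∃ R : E3 ≃ₗᵢ[ℝ] E3, IsRotation R ∧ IsSelfSimSolution α β c R Ap Am := by
  obtain ⟨A, hA⟩ := h.exists_tendsto hα
  have hA0 : A 0 = a :=
    tendsto_nhds_unique (((EuclideanSpace.proj (𝕜 := ℝ) (0 : Fin 3)).continuous.tendsto A).comp hA)
      ha
  have hA' : Tendsto m atBot (𝓝 (halfTurn A)) := by
    refine ((halfTurn.continuous.tendsto A).comp (hA.comp tendsto_neg_atBot_atTop)).congr
      fun x => ?_
    have hx := h.reflect (-x)
    rw [neg_neg] at hx
    simp only [Function.comp_apply, hx, halfTurn_apply]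
  have hnA : ‖A‖ = 1 := tendsto_nhds_unique hA.norm
    (tendsto_const_nhds.congr fun x => (h.norm_eq x).1.symm)
  have hsq : A 0 ^ 2 + A 1 ^ 2 + A 2 ^ 2 = 1 := by rw [← norm_sq_E3, hnA, one_pow]
  have hnA' : ‖halfTurn A‖ = 1 := by
    refine (sq_eq_sq₀ (norm_nonneg _) zero_le_one).1 ?_
    rw [norm_sq_E3, halfTurn_apply, one_pow, ← hsq]
    simp [toE3]
  obtain ⟨R, hR, hRA, hRA'⟩ := exists_isRotation hnA hnA' hAp hAm (by
    rw [← hangle, inner_E3, halfTurn_apply, ← hA0]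
    simp only [toE3, WithLp.equiv_symm_apply, Matrix.cons_val_zero, Matrix.cons_val_one,
      Matrix.cons_val]
    linarith)
  refine ⟨R, hR, ?_⟩
  rw [← hRA, ← hRA']
  exact h.isSelfSimSolution hα.le hαβ hc hA hA' hR

/-- The first component of the limit at `+∞` of the curve of curvature `c e^{-αx²/4}` and torsion
`βx/2`. -/
def frenetLimit (α β c : ℝ) : ℝ := limUnder atTop fun x => (exists_isSF α β c).choose x 0

theorem IsSF.tendsto_frenetLimit {α β c : ℝ} {m n b : ℝ → E3} (h : IsSF α β c m n b)
    (hα : 0 < α) : Tendsto (fun x => m x 0) atTop (𝓝 (frenetLimit α β c)) := by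
  obtain ⟨n', b', h'⟩ := (exists_isSF α β c).choose_spec
  rw [frenetLimit, (h'.unique h).1]
  obtain ⟨A, hA⟩ := h.exists_tendsto hα
  exact tendsto_nhds_limUnder
    ⟨A 0, ((EuclideanSpace.proj (𝕜 := ℝ) (0 : Fin 3)).continuous.tendsto A).comp hA⟩

theorem IsFrenet.sq_sub_le {κ τ u v w κ' τ' u' v' w' g G : ℝ → ℝ} (h : IsFrenet κ τ u v w)
    (h' : IsFrenet κ' τ' u' v' w') (hn : ∀ x, u x ^ 2 + v x ^ 2 + w x ^ 2 = 1)
    (hn' : ∀ x, u' x ^ 2 + v' x ^ 2 + w' x ^ 2 = 1)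
    (h0 : u 0 * u' 0 + v 0 * v' 0 + w 0 * w' 0 = 1) (hG : ∀ x, HasDerivAt G (g x) x)
    (hG0 : G 0 = 0) (hg : ∀ x, 0 ≤ x → |κ x - κ' x| + |τ x - τ' x| ≤ g x) {x : ℝ} (hx : 0 ≤ x) :
    (u x - u' x) ^ 2 ≤ 2 * G x := by
  have hd : ∀ x, HasDerivAt (fun x => G x + (u x * u' x + v x * v' x + w x * w' x))
      (g x + ((κ x - κ' x) * (v x * u' x - u x * v' x)
        + (τ x - τ' x) * (w x * v' x - v x * w' x))) x := fun x => by
    obtain ⟨h1, h2, h3⟩ := h x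
    obtain ⟨h1', h2', h3'⟩ := h' x
    refine ((hG x).add (((h1.mul h1').add (h2.mul h2')).add (h3.mul h3'))).congr_deriv ?_
    ring
  have hminor : ∀ {p q r p' q' r' : ℝ}, p ^ 2 + q ^ 2 + r ^ 2 = 1 → p' ^ 2 + q' ^ 2 + r' ^ 2 = 1 →
      |q * p' - p * q'| ≤ 1 := fun {p q r p' q' r'} h1 h2 => by
    rw [← sq_le_one_iff_abs_le_one]
    calc (q * p' - p * q') ^ 2 ≤ (p ^ 2 + q ^ 2) * (p' ^ 2 + q' ^ 2) := by
          nlinarith [sq_nonneg (q * q' + p * p')]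
      _ ≤ 1 * 1 := mul_le_mul (by nlinarith [sq_nonneg r]) (by nlinarith [sq_nonneg r'])
          (by positivity) zero_le_one
      _ = 1 := one_mul 1
  have hmono : MonotoneOn (fun x => G x + (u x * u' x + v x * v' x + w x * w' x)) (Set.Ici 0) := by
    refine monotoneOn_of_deriv_nonneg (convex_Ici 0)
      (fun x _ => (hd x).continuousAt.continuousWithinAt)
      (fun x _ => (hd x).differentiableAt.differentiableWithinAt) fun x hx => ?_
    rw [interior_Ici] at hx
    rw [(hd x).deriv]
    have b1 : |(κ x - κ' x) * (v x * u' x - u x * v' x)| ≤ |κ x - κ' x| := by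
      rw [abs_mul]
      exact mul_le_of_le_one_right (abs_nonneg _) (hminor (hn x) (hn' x))
    have b2 : |(τ x - τ' x) * (w x * v' x - v x * w' x)| ≤ |τ x - τ' x| := by
      rw [abs_mul]
      exact mul_le_of_le_one_right (abs_nonneg _) (hminor (r := u x) (r' := u' x)
        (by linarith [hn x]) (by linarith [hn' x]))
    linarith [hg x (le_of_lt hx), (abs_le.1 b1).1, (abs_le.1 b2).1]
  have hle := hmono (Set.self_mem_Ici) (Set.mem_Ici.2 hx) hx
  simp only [hG0, h0] at hle
  nlinarith [hn x, hn' x, sq_nonneg (v x - v' x), sq_nonneg (w x - w' x)]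

theorem exp_curvature_le {α : ℝ} (hα : 1 / 2 ≤ α) (x : ℝ) :
    Real.exp (-α * x ^ 2 / 4) ≤ 8 * (1 / (1 + x ^ 2)) := by
  have h1 : 0 < 1 + x ^ 2 := by positivity
  have h2 : (1 + x ^ 2) / 8 ≤ Real.exp (α * x ^ 2 / 4) := by
    have := Real.add_one_le_exp (α * x ^ 2 / 4)
    nlinarith [sq_nonneg x]
  rw [show -α * x ^ 2 / 4 = -(α * x ^ 2 / 4) by ring, Real.exp_neg]
  calc (Real.exp (α * x ^ 2 / 4))⁻¹ ≤ ((1 + x ^ 2) / 8)⁻¹ := by gcongr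
    _ = _ := by field_simp

theorem IsSF.dot_zero {α β c α' β' c' : ℝ} {m n b m' n' b' : ℝ → E3} (h : IsSF α β c m n b)
    (h' : IsSF α' β' c' m' n' b') :
    m 0 0 * m' 0 0 + n 0 0 * n' 0 0 + b 0 0 * b' 0 0 = 1 := by
  obtain ⟨-, -, -, hm, hn, hb⟩ := h
  obtain ⟨-, -, -, hm', hn', hb'⟩ := h'
  simp [hm, hn, hb, hm', hn', hb', e1_apply, e2_apply, e3_apply]

theorem frenetLimit_sq_sub_le {α : ℝ} (hα : 1 / 2 ≤ α) (β c c' : ℝ) :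
    (frenetLimit α β c - frenetLimit α β c') ^ 2 ≤ 8 * π * |c - c'| := by
  obtain ⟨m, n, b, h⟩ := exists_isSF α β c
  obtain ⟨m', n', b', h'⟩ := exists_isSF α β c'
  have hα0 : 0 < α := by linarith
  refine le_of_tendsto (((h.tendsto_frenetLimit hα0).sub (h'.tendsto_frenetLimit hα0)).pow 2) ?_
  filter_upwards [eventually_ge_atTop 0] with x hx
  refine ((h.isFrenet 0).sq_sub_le (h'.isFrenet 0) (h.row_norm 0) (h'.row_norm 0) (h.dot_zero h')
    (g := fun x => |c - c'| * (8 * (1 / (1 + x ^ 2))))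
    (G := fun x => |c - c'| * (8 * Real.arctan x))
    (fun x => ((Real.hasDerivAt_arctan x).const_mul 8).const_mul _) (by simp)
    (fun x _ => ?_) hx).trans ?_
  · rw [sub_self, abs_zero, add_zero, curvature, curvature, ← sub_mul, abs_mul,
      abs_of_pos (Real.exp_pos _)]
    exact mul_le_mul_of_nonneg_left (exp_curvature_le hα x) (abs_nonneg _)
  · have := mul_le_mul_of_nonneg_left (Real.arctan_lt_pi_div_two x).le (abs_nonneg (c - c'))
    linarith

theorem continuous_frenetLimit {α : ℝ} (hα : 1 / 2 ≤ α) (β : ℝ) :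
    Continuous (frenetLimit α β) := by
  refine continuous_iff_continuousAt.2 fun c => tendsto_iff_dist_tendsto_zero.2 ?_
  have hlim : Tendsto (fun c' => √(8 * π * |c' - c|)) (𝓝 c) (𝓝 0) := by
    have : Continuous fun c' => √(8 * π * |c' - c|) := by fun_prop
    simpa using this.tendsto c
  refine squeeze_zero (fun _ => dist_nonneg) (fun c' => ?_) hlim
  rw [Real.dist_eq]
  exact Real.abs_le_sqrt (frenetLimit_sq_sub_le hα β c' c)

theorem IsSF.abs_sub_frenetLimit_le {α β c : ℝ} {m n b : ℝ → E3} (h : IsSF α β c m n b)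
    (hα : 1 / 2 ≤ α) (hc : 0 ≤ c) (T : ℝ) :
    |m T 0 - frenetLimit α β c| ≤ 8 * c * (π / 2 - Real.arctan T) := by
  have hbound : ∀ x, |curvature α c x * n x 0| ≤ 8 * c * (1 / (1 + x ^ 2)) := fun x => by
    have hn : |n x 0| ≤ 1 := by
      rw [← sq_le_one_iff_abs_le_one]
      nlinarith [h.row_norm 0 x, sq_nonneg (m x 0), sq_nonneg (b x 0)]
    rw [abs_mul, abs_of_nonneg (curvature_nonneg hc x)]
    refine (mul_le_of_le_one_right (curvature_nonneg hc x) hn).trans ?_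
    have := mul_le_mul_of_nonneg_left (exp_curvature_le hα x) hc
    unfold curvature
    linarith
  have hmono : ∀ s : ℝ, |s| = 1 → Monotone fun x => 8 * c * Real.arctan x + s * m x 0 := by
    intro s hs
    have hd : ∀ x, HasDerivAt (fun x => 8 * c * Real.arctan x + s * m x 0)
        (8 * c * (1 / (1 + x ^ 2)) + s * (curvature α c x * n x 0)) x := fun x =>
      ((Real.hasDerivAt_arctan x).const_mul _).add ((h.isFrenet 0 x).1.const_mul s)
    refine monotone_of_deriv_nonneg (fun x => (hd x).differentiableAt) fun x => ?_
    rw [(hd x).deriv]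
    have : |s * (curvature α c x * n x 0)| ≤ 8 * c * (1 / (1 + x ^ 2)) := by
      rw [abs_mul, hs, one_mul]
      exact hbound x
    linarith [(abs_le.1 this).1]
  refine le_of_tendsto (tendsto_const_nhds.sub (h.tendsto_frenetLimit (by linarith))).abs ?_
  filter_upwards [eventually_ge_atTop T] with X hX
  have h1 := hmono 1 (by simp) hX
  have h2 := hmono (-1) (by simp) hX
  have h3 := mul_le_mul_of_nonneg_left (Real.arctan_lt_pi_div_two X).le (by linarith : 0 ≤ 8 * c)
  simp only at h1 h2
  rw [abs_le]
  constructor <;> linarith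

theorem tendsto_frenetLimit_one {c : ℝ} (hc : 0 ≤ c) :
    Tendsto (fun α => frenetLimit α √(1 - α ^ 2) c) (𝓝[Set.Icc (1 / 2) 1] 1)
      (𝓝 (frenetLimit 1 0 c)) := by
  rw [Metric.tendsto_nhds]
  intro ε hε
  have htail : ∃ T : ℝ, 0 ≤ T ∧ 8 * c * (π / 2 - Real.arctan T) < ε / 3 := by
    have hlim : Tendsto (fun T => 8 * c * (π / 2 - Real.arctan T)) atTop (𝓝 0) := by
      have := ((tendsto_const_nhds (x := π / 2)).sub
        (Real.tendsto_arctan_atTop.mono_right nhdsWithin_le_nhds)).const_mul (8 * c)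
      simpa using this
    obtain ⟨T, hT, hT0⟩ := ((hlim.eventually_lt_const (by positivity : 0 < ε / 3)).and
      (eventually_ge_atTop 0)).exists
    exact ⟨T, hT0, hT⟩
  obtain ⟨T, hT0, hT⟩ := htail
  have hmid : ∀ᶠ α in 𝓝[Set.Icc (1 / 2 : ℝ) 1] 1,
      2 * (c * (1 - α) * T ^ 3 / 12 + √(1 - α ^ 2) * T ^ 2 / 4) < (ε / 3) ^ 2 := by
    have hcont : Continuous fun α : ℝ =>
        2 * (c * (1 - α) * T ^ 3 / 12 + √(1 - α ^ 2) * T ^ 2 / 4) := by fun_prop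
    refine (hcont.tendsto 1).mono_left nhdsWithin_le_nhds |>.eventually_lt_const ?_
    simp only [sub_self, one_pow, Real.sqrt_zero, mul_zero, zero_mul, zero_div, add_zero]
    positivity
  filter_upwards [hmid, self_mem_nhdsWithin] with α hα hαmem
  obtain ⟨m, n, b, h⟩ := exists_isSF α √(1 - α ^ 2) c
  obtain ⟨m', n', b', h'⟩ := exists_isSF 1 0 c
  have hsq := (h.isFrenet 0).sq_sub_le (h'.isFrenet 0) (h.row_norm 0) (h'.row_norm 0)
    (h.dot_zero h')
    (g := fun x => c * (1 - α) * x ^ 2 / 4 + √(1 - α ^ 2) * x / 2)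
    (G := fun x => c * (1 - α) * x ^ 3 / 12 + √(1 - α ^ 2) * x ^ 2 / 4)
    (fun x => ((((hasDerivAt_id x).pow 3).const_mul (c * (1 - α))).div_const 12 |>.add
      ((((hasDerivAt_id x).pow 2).const_mul √(1 - α ^ 2)).div_const 4)).congr_deriv (by
        simp
        ring)) (by simp) (fun x hx => ?_) hT0
  · have h1 := h.abs_sub_frenetLimit_le hαmem.1 hc T
    have h2 := h'.abs_sub_frenetLimit_le (by norm_num) hc T
    have h3 : |m T 0 - m' T 0| < ε / 3 := by
      rw [← abs_of_pos (by positivity : 0 < ε / 3)]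
      exact sq_lt_sq.1 (hsq.trans_lt hα)
    rw [Real.dist_eq]
    rw [abs_le] at h1 h2
    rw [abs_lt] at h3 ⊢
    constructor <;> linarith [h1.1, h1.2, h2.1, h2.2, h3.1, h3.2]
  · have hτ : |torsion √(1 - α ^ 2) x - torsion 0 x| = √(1 - α ^ 2) * x / 2 := by
      rw [torsion, torsion, zero_mul, zero_div, sub_zero, abs_of_nonneg (by positivity)]
    have hκ : |curvature α c x - curvature 1 c x| ≤ c * (1 - α) * x ^ 2 / 4 := by
      have hx2 : 0 ≤ (1 - α) * x ^ 2 / 4 :=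
        div_nonneg (mul_nonneg (sub_nonneg.2 hαmem.2) (sq_nonneg x)) (by norm_num)
      have he : Real.exp (-1 * x ^ 2 / 4)
          = Real.exp (-α * x ^ 2 / 4) * Real.exp (-((1 - α) * x ^ 2 / 4)) := by
        rw [← Real.exp_add]
        ring_nf
      have h1 := Real.add_one_le_exp (-((1 - α) * x ^ 2 / 4))
      have h2 : Real.exp (-((1 - α) * x ^ 2 / 4)) ≤ 1 := Real.exp_le_one_iff.2 (by linarith)
      have h3 : Real.exp (-α * x ^ 2 / 4) ≤ 1 := Real.exp_le_one_iff.2 (by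
        nlinarith [hαmem.1, sq_nonneg x])
      rw [curvature, curvature, ← mul_sub, abs_mul, abs_of_nonneg hc, he, ← mul_one_sub, abs_mul,
        abs_of_pos (Real.exp_pos _), abs_of_nonneg (sub_nonneg.2 h2)]
      calc _ ≤ c * (1 * ((1 - α) * x ^ 2 / 4)) := by
            refine mul_le_mul_of_nonneg_left (mul_le_mul h3 (by linarith) (by linarith)
              zero_le_one) hc
        _ = _ := by ring
    linarith

/-- Half of the total mass of the Gaussian `e^{-x²/4}` determines the limits when `α = 1`. -/
theorem exists_frenetLimit_one_eq_cos :
    ∃ L : ℝ, 0 < L ∧ ∀ c, frenetLimit 1 0 c = Real.cos (c * L) := by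
  set E : ℝ → ℝ := fun x => ∫ s in (0 : ℝ)..x, curvature 1 1 s with hE
  have hcont := continuous_curvature 1 1
  have hd : ∀ x, HasDerivAt E (curvature 1 1 x) x := fun x =>
    intervalIntegral.integral_hasDerivAt_right (hcont.intervalIntegrable _ _)
      (hcont.stronglyMeasurableAtFilter _ _) hcont.continuousAt
  have hE0 : E 0 = 0 := intervalIntegral.integral_same
  have hmono : StrictMono E := strictMono_of_deriv_pos fun x => by
    rw [(hd x).deriv, curvature]
    positivity
  have hlim := tendsto_limUnder_of_hasDerivAt_of_integrableOn_Ioi (a := 0) (fun x _ => hd x)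
    (integrable_curvature one_pos 1).integrableOn
  refine ⟨limUnder atTop E, ?_, fun c => ?_⟩
  · have h1 : E 0 < E 1 := hmono one_pos
    have h2 := hmono.monotone.ge_of_tendsto hlim 1
    linarith
  · have hF : IsFrenet (curvature 1 c) (torsion 0) (fun x => Real.cos (c * E x))
        (fun x => -Real.sin (c * E x)) (fun _ => 0) := by
      intro x
      have hκ : curvature 1 c x = c * curvature 1 1 x := by simp [curvature]
      have h := (hd x).const_mul c
      refine ⟨h.cos.congr_deriv (by rw [hκ]; ring), h.sin.neg.congr_deriv (by rw [hκ]; ring),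
        (hasDerivAt_const x 0).congr_deriv (by simp [torsion])⟩
    obtain ⟨m, n, b, h⟩ := exists_isSF 1 0 c
    refine tendsto_nhds_unique (h.tendsto_frenetLimit one_pos) ?_
    refine ((Real.continuous_cos.tendsto _).comp (hlim.const_mul c)).congr fun x => ?_
    refine (hF.unique (h.isFrenet 0) ?_ ?_ ?_ x).1 <;>
      simp [hE0, h.2.2.2.1, h.2.2.2.2.1, h.2.2.2.2.2, e1_apply, e2_apply, e3_apply]

theorem exists_isSelfSimSolution {α β c : ℝ} (hα : 0 < α) (hαβ : α ^ 2 + β ^ 2 = 1) (hc : 0 ≤ c)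
    {Ap Am : E3} (hAp : ‖Ap‖ = 1) (hAm : ‖Am‖ = 1)
    (hangle : 2 * frenetLimit α β c ^ 2 - 1 = ⟪Ap, Am⟫) :
    ∃ R : E3 ≃ₗᵢ[ℝ] E3, IsRotation R ∧ IsSelfSimSolution α β c R Ap Am := by
  obtain ⟨m, n, b, h⟩ := exists_isSF α β c
  exact h.exists_isSelfSimSolution hα hαβ hc (h.tendsto_frenetLimit hα) hAp hAm hangle

/-- multiplicity of smooth self-similar solutions of the LLG equation with the
same jump initial condition: at least `k` distinct ones for `α` close to `1`, and infinitely
many for `α = 1`. -/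
theorem multiple_selfsimilar_solutions
    (k : ℕ) (Ap Am : E3) (hAp : ‖Ap‖ = 1) (hAm : ‖Am‖ = 1)
    (θ : ℝ) (hθ : θ = InnerProductGeometry.angle Ap Am) :
    (θ ∈ Set.Ioo 0 π →
      ∃ αk ∈ Set.Ioo (0 : ℝ) 1, ∀ α ∈ Set.Icc αk 1,
        ∃ cs : Fin k → ℝ, StrictMono cs ∧ (∀ j, 0 < cs j) ∧
          ∃ R : Fin k → (E3 ≃ₗᵢ[ℝ] E3), ∀ j,
            IsRotation (R j) ∧
            IsSelfSimSolution α (Real.sqrt (1 - α ^ 2)) (cs j) (R j) Ap Am) ∧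
    (θ ∈ Set.Icc 0 π →
      ∃ cs : ℕ → ℝ, StrictMono cs ∧ (∀ j, 0 < cs j) ∧
        ∃ R : ℕ → (E3 ≃ₗᵢ[ℝ] E3), ∀ j,
          IsRotation (R j) ∧ IsSelfSimSolution 1 0 (cs j) (R j) Ap Am) := by
  have hcos : ⟪Ap, Am⟫ = Real.cos θ := by
    rw [hθ, InnerProductGeometry.cos_angle, hAp, hAm, mul_one, div_one]
  obtain ⟨L, hL, hlim⟩ := exists_frenetLimit_one_eq_cos
  have hpi := Real.pi_pos
  constructor
  · rintro ⟨hθ0, hθπ⟩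
    have hcos1 : Real.cos θ < 1 := by
      rw [← Real.cos_zero]
      exact Real.cos_lt_cos_of_nonneg_of_le_pi le_rfl hθπ.le hθ0
    have hcos2 : -1 < Real.cos θ := by
      rw [← Real.cos_pi]
      exact Real.cos_lt_cos_of_nonneg_of_le_pi hθ0.le le_rfl hθπ
    set q := (1 + Real.cos θ) / 2 with hq
    set p : Fin k → ℝ := fun j => ((j : ℕ) + 1) * π / L with hp
    set r : Fin k → ℝ := fun j => (((j : ℕ) + 1) * π + π / 2) / L with hr
    have hp0 : ∀ j, 0 < p j := fun j => by positivity
    have hpr : ∀ j, p j < r j := fun j => by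
      simp only [hp, hr]
      gcongr
      linarith
    have hsq : ∀ c, 0 ≤ c → Tendsto (fun α => frenetLimit α √(1 - α ^ 2) c ^ 2)
        (𝓝[Set.Icc (1 / 2) 1] 1) (𝓝 (Real.cos (c * L) ^ 2)) := fun c hc => by
      rw [← hlim c]
      exact (tendsto_frenetLimit_one hc).pow 2
    have hev : ∀ᶠ α in 𝓝[Set.Icc (1 / 2 : ℝ) 1] 1, ∀ j,
        q < frenetLimit α √(1 - α ^ 2) (p j) ^ 2 ∧ frenetLimit α √(1 - α ^ 2) (r j) ^ 2 < q := by
      refine eventually_all.2 fun j => ((hsq _ (hp0 j).le).eventually_const_lt ?_).and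
        ((hsq _ ((hp0 j).trans (hpr j)).le).eventually_lt_const ?_)
      · have harg : p j * L = ((j : ℕ) + 1 : ℕ) * π := by
          simp only [hp]
          push_cast
          field_simp
        have hs := Real.sin_nat_mul_pi ((j : ℕ) + 1)
        rw [harg, Real.cos_sq', hs]
        linarith
      · have harg : r j * L = ((j : ℕ) + 1 : ℕ) * π + π / 2 := by
          simp only [hr]
          push_cast
          field_simp
        rw [harg, Real.cos_add_pi_div_two, Real.sin_nat_mul_pi]
        linarith
    obtain ⟨δ, hδ, hball⟩ := Metric.eventually_nhds_iff.1 (eventually_nhdsWithin_iff.1 hev)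
    refine ⟨max (1 / 2) (1 - δ / 2), ⟨lt_max_of_lt_left (by norm_num),
      max_lt (by norm_num) (by linarith)⟩, fun α hα => ?_⟩
    have hα1 : 1 / 2 ≤ α := (le_max_left _ _).trans hα.1
    have hα2 : 1 - δ / 2 ≤ α := (le_max_right _ _).trans hα.1
    have hα3 := hα.2
    have hdist : dist α 1 < δ := by
      rw [Real.dist_eq, abs_lt]
      constructor <;> linarith
    have hsign := hball hdist ⟨hα1, hα3⟩
    have hroot : ∀ j, ∃ c ∈ Set.Ioo (p j) (r j), frenetLimit α √(1 - α ^ 2) c ^ 2 = q := fun j =>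
      intermediate_value_Ioo' (hpr j).le
        (((continuous_frenetLimit hα1 _).pow 2).continuousOn) ⟨(hsign j).2, (hsign j).1⟩
    choose cs hcs hcsq using hroot
    have hαβ : α ^ 2 + √(1 - α ^ 2) ^ 2 = 1 := by
      rw [Real.sq_sqrt (by nlinarith)]
      ring
    refine ⟨cs, fun i j hij => ?_, fun j => (hp0 j).trans (hcs j).1, ?_⟩
    · refine (hcs i).2.trans (lt_trans ?_ (hcs j).1)
      have hij' : ((i : ℕ) : ℝ) + 1 ≤ (j : ℕ) := by exact_mod_cast hij
      simp only [hp, hr]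
      gcongr
      nlinarith
    · choose R hR using fun j => exists_isSelfSimSolution (by linarith) hαβ
        ((hp0 j).trans (hcs j).1).le hAp hAm (by rw [hcsq, hcos, hq]; ring)
      exact ⟨R, hR⟩
  · rintro ⟨hθ0, -⟩
    set cs : ℕ → ℝ := fun j => (θ + (j + 1 : ℕ) * (2 * π)) / (2 * L) with hcs
    have hpos : ∀ j, 0 < cs j := fun j => by
      simp only [hcs]
      positivity
    refine ⟨cs, fun i j hij => ?_, hpos, ?_⟩
    · simp only [hcs]
      gcongr
    · choose R hR using fun j => exists_isSelfSimSolution (β := 0) one_pos (by norm_num)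
        (hpos j).le hAp hAm (by
          rw [hlim, ← Real.cos_two_mul, hcos, ← Real.cos_add_nat_mul_two_pi θ (j + 1)]
          congr 1
          simp only [hcs]
          field_simp)
      exact ⟨R, hR⟩
end
end

section
/- Let α ∈ (0,1], β = √(1−α²), c > 0, and let f_{c,α} be the shrinker profile. Then there exist unit vectors B⁺, B⁻ ∈ S² such that, denoting by C^± = { y ∈ S² : ⟨y, B^±⟩ = 0 } the great circles obtained by intersecting S² with the planes through the origin normal to B^±, one has dist( f_{c,α}(x), C⁺ ) ≤ (15√2 β /(c α²)) |x| e^{−αx²/4} for all x ≥ 1, and dist( f_{c,α}(x), C⁻ ) ≤ (15√2 β /(c α²)) |x| e^{−αx²/4} for all x ≤ −1. In particular, the distance from f_{c,α}(x) to the great circle C^± tends to 0 as x → ±∞. -/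
noncomputable section

open Real MeasureTheory Filter Topology
open scoped RealInnerProductSpace

/-- `(f, g, h)` solves the Serret–Frenet system with curvature `k(x) = c e^{αx²/4}`,
torsion `τ(x) = -βx/2` and initial conditions `(e₁, e₂, e₃)`. -/
def IsSFShrink (α β c : ℝ) (f g h : ℝ → E3) : Prop :=
  (∀ x : ℝ, HasDerivAt f ((c * Real.exp (α * x ^ 2 / 4)) • g x) x) ∧
  (∀ x : ℝ, HasDerivAt g
    ((-(c * Real.exp (α * x ^ 2 / 4))) • f x + (-(β * x / 2)) • h x) x) ∧
  (∀ x : ℝ, HasDerivAt h ((β * x / 2) • g x) x) ∧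
  f 0 = e1 ∧ g 0 = e2 ∧ h 0 = e3

/-- The great circle of `S²` cut out by the plane through the origin with normal vector `B`. -/
def greatCircle (B : E3) : Set E3 := {y : E3 | ‖y‖ = 1 ∧ ⟪y, B⟫ = 0}

/-- A Serret–Frenet frame which is orthonormal at `0` has `f`, `h` orthonormal at all times: the
squared Frobenius distance from the Gram matrix to the identity is a conserved quantity. -/
lemma frenet_orthonormal {k τ : ℝ → ℝ} {f g h : ℝ → E3}
    (hf : ∀ x, HasDerivAt f (k x • g x) x)
    (hg : ∀ x, HasDerivAt g ((-(k x)) • f x + τ x • h x) x)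
    (hh : ∀ x, HasDerivAt h ((-(τ x)) • g x) x)
    (hf0 : f 0 = e1) (hg0 : g 0 = e2) (hh0 : h 0 = e3) (x : ℝ) :
    ‖f x‖ = 1 ∧ ‖h x‖ = 1 ∧ ⟪f x, h x⟫ = 0 := by
  let E : ℝ → ℝ := fun x => (⟪f x, f x⟫ - 1) ^ 2 + (⟪g x, g x⟫ - 1) ^ 2 + (⟪h x, h x⟫ - 1) ^ 2
    + 2 * (⟪f x, g x⟫ ^ 2 + ⟪f x, h x⟫ ^ 2 + ⟪g x, h x⟫ ^ 2)
  have hE : ∀ x, HasDerivAt E 0 x := by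
    intro x
    have H := ((((((hf x).inner ℝ (hf x)).sub_const 1).pow 2).add
      ((((hg x).inner ℝ (hg x)).sub_const 1).pow 2)).add
      ((((hh x).inner ℝ (hh x)).sub_const 1).pow 2)).add
      ((((((hf x).inner ℝ (hg x)).pow 2).add (((hf x).inner ℝ (hh x)).pow 2)).add
        (((hg x).inner ℝ (hh x)).pow 2)).const_mul 2)
    refine H.congr_deriv ?_
    simp only [inner_add_left, inner_add_right, real_inner_smul_left, real_inner_smul_right,
      real_inner_comm (f x) (g x), real_inner_comm (g x) (h x)]
    push_cast
    ring
  have hconst : E x = E 0 :=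
    is_const_of_deriv_eq_zero (fun y => (hE y).differentiableAt) (fun y => (hE y).deriv) x 0
  have hE0 : E 0 = 0 := by
    simp [E, hf0, hg0, hh0, e1, e2, e3, EuclideanSpace.inner_single_left]
  have hEx : (⟪f x, f x⟫ - 1) ^ 2 + (⟪g x, g x⟫ - 1) ^ 2 + (⟪h x, h x⟫ - 1) ^ 2
    + 2 * (⟪f x, g x⟫ ^ 2 + ⟪f x, h x⟫ ^ 2 + ⟪g x, h x⟫ ^ 2) = 0 := hconst.trans hE0
  have unit : ∀ v : E3, (⟪v, v⟫ - 1) ^ 2 = 0 → ‖v‖ = 1 := by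
    intro v hv
    rw [real_inner_self_eq_norm_sq, sq_eq_zero_iff, sub_eq_zero] at hv
    exact (pow_eq_one_iff_of_nonneg (norm_nonneg v) two_ne_zero).1 hv
  have h1 := sq_nonneg (⟪f x, f x⟫ - 1)
  have h2 := sq_nonneg (⟪g x, g x⟫ - 1)
  have h3 := sq_nonneg (⟪h x, h x⟫ - 1)
  have h4 := sq_nonneg ⟪f x, g x⟫
  have h5 := sq_nonneg ⟪f x, h x⟫
  have h6 := sq_nonneg ⟪g x, h x⟫
  exact ⟨unit _ (by linarith), unit _ (by linarith), pow_eq_zero_iff two_ne_zero |>.1 (by linarith)⟩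

/-- A decomposition `y = s B + t u` with `u` on the great circle bounds the distance of `y` to the
great circle by `√2 |s|`. -/
lemma dist_le_of_decomposition {y B u : E3} {s t : ℝ} (hB : ‖B‖ = 1) (hu : ‖u‖ = 1)
    (huB : ⟪u, B⟫ = 0) (ht : 0 ≤ t) (hst : s ^ 2 + t ^ 2 = 1) (hy : y = s • B + t • u) :
    dist y u ≤ √2 * |s| := by
  have hsq : ‖y - u‖ ^ 2 = s ^ 2 + (t - 1) ^ 2 := by
    have : y - u = s • B + (t - 1) • u := by rw [hy]; module
    rw [this, norm_add_sq_real, norm_smul, norm_smul, hB, hu, real_inner_smul_left,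
      real_inner_smul_right, real_inner_comm, huB]
    simp
  rw [dist_eq_norm]
  refine (sq_le_sq₀ (norm_nonneg _) (by positivity)).1 ?_
  rw [hsq, mul_pow, Real.sq_sqrt (by norm_num), sq_abs]
  nlinarith

/-- The distance from a unit vector `y` to the great circle normal to `B` is at most
`√2 |⟪y, B⟫|`. -/
lemma infDist_greatCircle_le {y B : E3} (hy : ‖y‖ = 1) (hB : ‖B‖ = 1) :
    Metric.infDist y (greatCircle B) ≤ √2 * |⟪y, B⟫| := by
  set s := ⟪y, B⟫ with hs
  set w := y - s • B with hw
  have hwB : ⟪w, B⟫ = 0 := by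
    rw [hw, inner_sub_left, real_inner_smul_left, real_inner_self_eq_norm_sq, hB, ← hs]; ring
  have hwsq : s ^ 2 + ‖w‖ ^ 2 = 1 := by
    rw [hw, norm_sub_sq_real, hy, norm_smul, hB, real_inner_smul_right, ← hs, Real.norm_eq_abs,
      mul_one, sq_abs]
    ring
  by_cases h0 : w = 0
  · rcases (greatCircle B).eq_empty_or_nonempty with he | ⟨u, hu⟩
    · rw [he, Metric.infDist_empty]; positivity
    · refine (Metric.infDist_le_dist_of_mem hu).trans ?_
      refine dist_le_of_decomposition (t := 0) hB hu.1 hu.2 le_rfl (by simpa [h0] using hwsq) ?_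
      rw [zero_smul, add_zero]
      exact sub_eq_zero.1 h0
  · have hn : ‖w‖ ≠ 0 := norm_ne_zero_iff.2 h0
    have hu : ‖‖w‖⁻¹ • w‖ = 1 := by
      rw [norm_smul, norm_inv, norm_norm, inv_mul_cancel₀ hn]
    have huB : ⟪‖w‖⁻¹ • w, B⟫ = 0 := by rw [real_inner_smul_left, hwB, mul_zero]
    refine (Metric.infDist_le_dist_of_mem (s := greatCircle B) ⟨hu, huB⟩).trans ?_
    refine dist_le_of_decomposition hB hu huB (norm_nonneg w) hwsq ?_
    rw [smul_inv_smul₀ hn, hw]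
    abel

lemma hasDerivAt_gaussian (α x : ℝ) :
    HasDerivAt (fun x => Real.exp (-α * x ^ 2 / 4))
      (-(α * x / 2) * Real.exp (-α * x ^ 2 / 4)) x := by
  have h : HasDerivAt (fun x : ℝ => -α * x ^ 2 / 4) (-(α * x / 2)) x :=
    (((hasDerivAt_pow 2 x).const_mul (-α)).div_const 4).congr_deriv (by push_cast; ring)
  exact h.exp.congr_deriv (by ring)

lemma tendsto_mul_gaussian {α : ℝ} (hα : 0 < α) :
    Tendsto (fun x => x * Real.exp (-α * x ^ 2 / 4)) atTop (𝓝 0) := by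
  have hlim : Tendsto (fun x : ℝ => (4 / α) * x⁻¹) atTop (𝓝 0) := by
    simpa using tendsto_inv_atTop_zero.const_mul (4 / α)
  refine squeeze_zero' ?_ ?_ hlim
  · filter_upwards [eventually_ge_atTop 0] with x hx using by positivity
  · filter_upwards [eventually_gt_atTop 0] with x hx
    have h1 := Real.add_one_le_exp (α * x ^ 2 / 4)
    have h2 : Real.exp (-α * x ^ 2 / 4) = (Real.exp (α * x ^ 2 / 4))⁻¹ := by
      rw [← Real.exp_neg]; congr 1; ring
    have h3 : 0 < α * x ^ 2 / 4 := by positivity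
    rw [h2]
    calc x * (Real.exp (α * x ^ 2 / 4))⁻¹ ≤ x * (α * x ^ 2 / 4)⁻¹ := by
          gcongr; linarith
      _ = (4 / α) * x⁻¹ := by field_simp

/-- A differentiable curve on `[1, ∞)` whose speed is dominated by `-M'`, where `M ≥ 0` tends to
`0`, converges at rate `M`. -/
lemma exists_limit_of_norm_deriv_le {H H' : ℝ → E3} {M M' : ℝ → ℝ}
    (hH : ∀ x, 1 ≤ x → HasDerivAt H (H' x) x) (hM : ∀ x, 1 ≤ x → HasDerivAt M (M' x) x)
    (hle : ∀ x, 1 ≤ x → ‖H' x‖ ≤ -M' x) (hM0 : ∀ x, 1 ≤ x → 0 ≤ M x)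
    (hlim : Tendsto M atTop (𝓝 0)) :
    ∃ B, Tendsto H atTop (𝓝 B) ∧ ∀ x, 1 ≤ x → ‖B - H x‖ ≤ M x := by
  have key : ∀ x y, 1 ≤ x → x ≤ y → ‖H y - H x‖ ≤ M x := by
    intro x y hx hxy
    have := image_norm_le_of_norm_deriv_right_le_deriv_boundary' (f := fun t => H t - H x)
      (f' := H') (a := x) (b := y) (B := fun t => M x - M t) (B' := fun t => -M' t)
      (fun t ht => ((hH t (hx.trans ht.1)).sub_const _).continuousAt.continuousWithinAt)
      (fun t ht => ((hH t (hx.trans ht.1)).sub_const _).hasDerivWithinAt)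
      (by simp)
      (fun t ht => ((hM t (hx.trans ht.1)).const_sub (M x)).continuousAt.continuousWithinAt)
      (fun t ht => ((hM t (hx.trans ht.1)).const_sub _).hasDerivWithinAt)
      (fun t ht => hle t (hx.trans ht.1)) ⟨hxy, le_rfl⟩
    exact this.trans (by linarith [hM0 y (hx.trans hxy)])
  have hmax : ∀ᶠ x : ℝ in atTop, max 1 x = x := by
    filter_upwards [eventually_ge_atTop 1] with x hx using max_eq_right hx
  have hc : CauchySeq fun x => H (max 1 x) := by
    refine cauchySeq_of_le_tendsto_0' (fun x => M (max 1 x)) (fun x y hxy => ?_)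
      (hlim.congr' (hmax.mono fun x hx => by simp only [hx]))
    rw [dist_comm, dist_eq_norm]
    exact key _ _ (le_max_left _ _) (max_le_max_left _ hxy)
  obtain ⟨B, hB⟩ := cauchySeq_tendsto_of_complete hc
  have hB' : Tendsto H atTop (𝓝 B) := hB.congr' (hmax.mono fun x hx => by rw [hx])
  refine ⟨B, hB', fun x hx => ?_⟩
  refine le_of_tendsto (hB'.sub_const (H x)).norm ?_
  filter_upwards [eventually_ge_atTop x] with y hy using key x y hx hy

/-- Along a solution of the Frenet equations for `f` and `h`, the binormal `h` converges at `+∞`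
and `f` approaches the great circle normal to the limit. -/
lemma exists_limit_great_circle {α β c : ℝ} (hα : 0 < α) (hα1 : α ≤ 1) (hβ : 0 ≤ β) (hc : 0 < c)
    {f g h : ℝ → E3}
    (hf : ∀ x, HasDerivAt f ((c * Real.exp (α * x ^ 2 / 4)) • g x) x)
    (hh : ∀ x, HasDerivAt h ((β * x / 2) • g x) x)
    (hort : ∀ x, ‖f x‖ = 1 ∧ ‖h x‖ = 1 ∧ ⟪f x, h x⟫ = 0) :
    ∃ B : E3, ‖B‖ = 1 ∧
      (∀ x : ℝ, 1 ≤ x →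
        Metric.infDist (f x) (greatCircle B)
          ≤ (15 * Real.sqrt 2 * β / (c * α ^ 2)) * |x| * Real.exp (-α * x ^ 2 / 4)) ∧
      Tendsto (fun x => Metric.infDist (f x) (greatCircle B)) atTop (𝓝 0) := by
  let e : ℝ → ℝ := fun x => Real.exp (-α * x ^ 2 / 4)
  let b : ℝ := β / (2 * c)
  have hb : 0 ≤ b := by positivity
  have he : ∀ x, 0 < e x := fun x => Real.exp_pos _
  have hde : ∀ x, HasDerivAt e (-(α * x / 2) * e x) x := hasDerivAt_gaussian α
  let φ : ℝ → ℝ := fun x => b * (x * e x)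
  have hφ : ∀ x, HasDerivAt φ (b * ((1 - α * x ^ 2 / 2) * e x)) x := fun x =>
    (((hasDerivAt_id x).mul (hde x)).const_mul b).congr_deriv (by simp only [id]; ring)
  have hφ0 : Tendsto φ atTop (𝓝 0) :=
    by simpa only [mul_zero] using (tendsto_mul_gaussian hα).const_mul b
  let M : ℝ → ℝ := fun x => φ x + b * (4 / α) * (e x / x)
  have hM : ∀ x, 1 ≤ x → HasDerivAt M (b * ((1 - α * x ^ 2 / 2) * e x)
      + b * (4 / α) * (-(α / 2 + 1 / x ^ 2) * e x)) x := by
    intro x hx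
    have hx0 : x ≠ 0 := by positivity
    refine (hφ x).add ((((hde x).div (hasDerivAt_id x) hx0).const_mul _).congr_deriv ?_)
    simp only [id]
    field_simp
    ring
  have hMφ : ∀ x, 1 ≤ x → M x ≤ φ x + 4 / α * φ x := by
    intro x hx
    have : e x / x ≤ x * e x := by
      rw [div_le_iff₀ (by linarith)]
      nlinarith [he x, mul_le_mul hx hx zero_le_one (by linarith)]
    have := mul_le_mul_of_nonneg_left this (show 0 ≤ b * (4 / α) by positivity)
    simp only [M, φ] at *
    linarith
  have hMnonneg : ∀ x, 1 ≤ x → 0 ≤ M x := by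
    intro x hx
    have := he x
    positivity
  have hM0 : Tendsto M atTop (𝓝 0) := by
    have hlim : Tendsto (fun x => φ x + 4 / α * φ x) atTop (𝓝 0) := by
      simpa using hφ0.add (hφ0.const_mul (4 / α))
    exact squeeze_zero' ((eventually_ge_atTop 1).mono hMnonneg)
      ((eventually_ge_atTop 1).mono hMφ) hlim
  -- integration by parts: `h' = φ f'`
  have hH : ∀ x, HasDerivAt (fun x => h x - φ x • f x)
      (-((b * ((1 - α * x ^ 2 / 2) * e x)) • f x)) x := by
    intro x
    refine ((hh x).sub ((hφ x).smul (hf x))).congr_deriv ?_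
    have hee : e x * Real.exp (α * x ^ 2 / 4) = 1 := by
      rw [← Real.exp_add, Real.exp_eq_one_iff]; ring
    have hcoef : φ x * (c * Real.exp (α * x ^ 2 / 4)) = β * x / 2 := by
      calc φ x * (c * Real.exp (α * x ^ 2 / 4))
          = b * x * c * (e x * Real.exp (α * x ^ 2 / 4)) := by simp only [φ]; ring
        _ = β * x / 2 := by rw [hee]; simp only [b]; field_simp
    rw [smul_smul, hcoef]
    abel
  obtain ⟨B, hB, hBM⟩ := exists_limit_of_norm_deriv_le (fun x _ => hH x) hM (fun x hx => by
      rw [norm_neg, norm_smul, (hort x).1, mul_one, Real.norm_eq_abs, abs_mul, abs_mul,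
        abs_of_nonneg hb, abs_of_pos (he x)]
      have hx0 : x ≠ 0 := by positivity
      have h1 : |1 - α * x ^ 2 / 2| ≤ 1 + α * x ^ 2 / 2 := by
        have : 0 ≤ α * x ^ 2 / 2 := by positivity
        rw [abs_le]; constructor <;> linarith
      have h2 : -(b * ((1 - α * x ^ 2 / 2) * e x) + b * (4 / α) * (-(α / 2 + 1 / x ^ 2) * e x))
          = b * ((1 + α * x ^ 2 / 2 + 4 / (α * x ^ 2)) * e x) := by
        field_simp
        ring
      rw [h2]
      have h3 : 0 ≤ 4 / (α * x ^ 2) := by positivity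
      have := he x
      gcongr
      linarith) hMnonneg hM0
  have hφf : Tendsto (fun x => φ x • f x) atTop (𝓝 0) := by
    refine squeeze_zero_norm (fun x => ?_) (by simpa using hφ0.abs)
    rw [norm_smul, (hort x).1, mul_one, Real.norm_eq_abs]
  have hhB : Tendsto h atTop (𝓝 B) := by simpa using hB.add hφf
  have hB1 : ‖B‖ = 1 := by
    refine tendsto_nhds_unique hhB.norm ?_
    simp only [fun x => (hort x).2.1]
    exact tendsto_const_nhds
  have hdist : ∀ x, Metric.infDist (f x) (greatCircle B) ≤ √2 * ‖B - h x‖ := by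
    intro x
    refine (infDist_greatCircle_le (hort x).1 hB1).trans ?_
    have : ⟪f x, B⟫ = ⟪f x, B - h x⟫ := by rw [inner_sub_right, (hort x).2.2, sub_zero]
    rw [this]
    gcongr
    simpa [(hort x).1] using abs_real_inner_le_norm (f x) (B - h x)
  refine ⟨B, hB1, fun x hx => (hdist x).trans ?_, ?_⟩
  · have hφx : 0 ≤ φ x := by have := he x; positivity
    have h1 : ‖B - h x‖ ≤ M x + φ x := by
      calc ‖B - h x‖ = ‖(B - (h x - φ x • f x)) - φ x • f x‖ := by congr 1; abel
        _ ≤ ‖B - (h x - φ x • f x)‖ + ‖φ x • f x‖ := norm_sub_le _ _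
        _ ≤ M x + φ x := by
            gcongr
            · exact hBM x hx
            · rw [norm_smul, (hort x).1, mul_one, Real.norm_eq_abs, abs_of_nonneg hφx]
    have h2 : ‖B - h x‖ ≤ (2 + 4 / α) * φ x := by linarith [hMφ x hx]
    have h3 : 2 + 4 / α ≤ 30 / α ^ 2 := by
      rw [le_div_iff₀ (by positivity)]
      have : (2 + 4 / α) * α ^ 2 = 2 * α ^ 2 + 4 * α := by field_simp
      nlinarith
    calc √2 * ‖B - h x‖ ≤ √2 * (30 / α ^ 2 * φ x) := by
          gcongr
          exact h2.trans (by gcongr)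
      _ = _ := by
          rw [abs_of_nonneg (by linarith : (0 : ℝ) ≤ x)]
          simp only [φ, b, e]
          field_simp
          ring
  · refine squeeze_zero (fun x => Metric.infDist_nonneg) hdist ?_
    simpa using ((tendsto_const_nhds (x := B)).sub hhB).norm.const_mul √2

/-- the shrinker profile `f_{c,α}` converges exponentially fast to great circles
`C^±` as `x → ±∞`. -/
theorem shrinker_limit_great_circles
    (α β c : ℝ) (hα : α ∈ Set.Ioc (0 : ℝ) 1) (hβ : β = Real.sqrt (1 - α ^ 2)) (hc : 0 < c)
    (f g h : ℝ → E3) (hSF : IsSFShrink α β c f g h) :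
    ∃ Bp Bm : E3, ‖Bp‖ = 1 ∧ ‖Bm‖ = 1 ∧
      (∀ x : ℝ, 1 ≤ x →
        Metric.infDist (f x) (greatCircle Bp)
          ≤ (15 * Real.sqrt 2 * β / (c * α ^ 2)) * |x| * Real.exp (-α * x ^ 2 / 4)) ∧
      (∀ x : ℝ, x ≤ -1 →
        Metric.infDist (f x) (greatCircle Bm)
          ≤ (15 * Real.sqrt 2 * β / (c * α ^ 2)) * |x| * Real.exp (-α * x ^ 2 / 4)) ∧
      Tendsto (fun x => Metric.infDist (f x) (greatCircle Bp)) atTop (nhds 0) ∧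
      Tendsto (fun x => Metric.infDist (f x) (greatCircle Bm)) atBot (nhds 0) := by
  obtain ⟨hf, hg, hh, hf0, hg0, hh0⟩ := hSF
  have hβ0 : 0 ≤ β := hβ ▸ Real.sqrt_nonneg _
  have hort := frenet_orthonormal hf hg (fun x => (hh x).congr_deriv (by rw [neg_neg]))
    hf0 hg0 hh0
  obtain ⟨Bp, hBp, hp, hp'⟩ := exists_limit_great_circle hα.1 hα.2 hβ0 hc hf hh hort
  have hfr : ∀ x, HasDerivAt (fun x => f (-x))
      ((c * Real.exp (α * x ^ 2 / 4)) • (-g (-x))) x := fun x =>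
    ((hf (-x)).scomp x (hasDerivAt_neg x)).congr_deriv (by rw [neg_sq]; module)
  have hhr : ∀ x, HasDerivAt (fun x => -h (-x)) ((β * x / 2) • (-g (-x))) x := fun x =>
    ((hh (-x)).scomp x (hasDerivAt_neg x)).neg.congr_deriv (by module)
  obtain ⟨Bm, hBm, hm, hm'⟩ := exists_limit_great_circle (g := fun x => -g (-x))
    hα.1 hα.2 hβ0 hc hfr hhr
    (fun x => ⟨(hort (-x)).1, by rw [norm_neg]; exact (hort (-x)).2.1,
      by rw [inner_neg_right, (hort (-x)).2.2, neg_zero]⟩)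
  refine ⟨Bp, Bm, hBp, hBm, hp, fun x hx => ?_, hp', ?_⟩
  · simpa using hm (-x) (by linarith)
  · simpa [Function.comp_def] using hm'.comp tendsto_neg_atBot_atTop
end
end
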